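/- arXiv:1210.2761 — 4 statements merged into one kernel-verified Lean document; each statement's English description precedes it below -/
import Mathlib

section
/- Let z be a real number with 0 < z ≤ 2 and let a ∈ (0,1). Then both pressures vanish in the limit of long paths: lim_{n→∞, n even} P_n^D(z; 2⌊an/2⌋) = 0 and lim_{n→∞, n even} P_n^T(z; 2⌊an/2⌋) = 0. -/
open Filter Real

/-- Partition function of adsorbing Dyck paths of length `2ν`:
`D_{2ν}(z) = Σ_{m=0}^{ν} ((2m+1)/(ν+m+1))·C(2ν, ν+m)·(z−1)^m`. -/
noncomputable def Dp (ν : ℕ) (z : ℝ) : ℝ :=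
  ∑ m ∈ Finset.range (ν + 1),
    ((2 * (m : ℝ) + 1) / ((ν : ℝ) + m + 1)) * (Nat.choose (2 * ν) (ν + m)) * (z - 1) ^ m

/-- Partition function of adsorbing directed paths of length `2ν`:
`T_{2ν}(z) = Σ_{m=0}^{ν} C(2ν, ν+m)·(z−1)^m`. -/
noncomputable def Tp (ν : ℕ) (z : ℝ) : ℝ :=
  ∑ m ∈ Finset.range (ν + 1), (Nat.choose (2 * ν) (ν + m) : ℝ) * (z - 1) ^ m

/-- Pressure of an adsorbing Dyck path of length `n = 2ν` at the point `q = 2κ`: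
`P_n^D(z;q) = log(1 − D_q(z)·D_{n−q}(z)/D_n(z))`. -/
noncomputable def PD (ν κ : ℕ) (z : ℝ) : ℝ :=
  Real.log (1 - Dp κ z * Dp (ν - κ) z / Dp ν z)

/-- Pressure of an adsorbing directed path of length `n = 2ν` at the point `q = 2κ`:
`P_n^T(z;q) = log(1 − D_q(z)·T_{n−q}(z)/T_n(z))`. -/
noncomputable def PT (ν κ : ℕ) (z : ℝ) : ℝ :=
  Real.log (1 - Dp κ z * Tp (ν - κ) z / Tp ν z)

/-- `k ↦ C(2k, k)² / 16^k` is at most `1 / (2k + 1)`. -/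
lemma two_mul_add_one_mul_centralBinom_sq_le (k : ℕ) :
    (2 * (k : ℝ) + 1) * (k.centralBinom : ℝ) ^ 2 ≤ 16 ^ k := by
  induction k with
  | zero => simp
  | succ k ih =>
    have h : ((k : ℝ) + 1) * ((k + 1).centralBinom : ℝ) = 2 * (2 * k + 1) * k.centralBinom := by
      exact_mod_cast Nat.succ_mul_centralBinom_succ k
    have hk : (0 : ℝ) < ((k : ℝ) + 1) ^ 2 := by positivity
    refine le_of_mul_le_mul_left ?_ hk
    calc ((k : ℝ) + 1) ^ 2 * ((2 * ((k + 1 : ℕ) : ℝ) + 1) * ((k + 1).centralBinom : ℝ) ^ 2)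
        = (2 * k + 3) * (((k : ℝ) + 1) * ((k + 1).centralBinom : ℝ)) ^ 2 := by push_cast; ring
      _ = 4 * (2 * k + 3) * (2 * k + 1) * ((2 * k + 1) * (k.centralBinom : ℝ) ^ 2) := by
        rw [h]; ring
      _ ≤ 4 * (2 * k + 3) * (2 * k + 1) * 16 ^ k := by gcongr
      _ ≤ (16 * ((k : ℝ) + 1) ^ 2) * 16 ^ k :=
        mul_le_mul_of_nonneg_right (by nlinarith) (by positivity)
      _ = ((k : ℝ) + 1) ^ 2 * 16 ^ (k + 1) := by ring

/-- `k ↦ C(2k, k)² / 16^k` is at least `1 / (4k)`. -/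
lemma pow_le_four_mul_centralBinom_sq {k : ℕ} (hk : 1 ≤ k) :
    (16 : ℝ) ^ k ≤ 4 * k * (k.centralBinom : ℝ) ^ 2 := by
  induction k, hk using Nat.le_induction with
  | base => norm_num [Nat.centralBinom, Nat.choose]
  | succ k hk ih =>
    have h : ((k : ℝ) + 1) * ((k + 1).centralBinom : ℝ) = 2 * (2 * k + 1) * k.centralBinom := by
      exact_mod_cast Nat.succ_mul_centralBinom_succ k
    have hk : (0 : ℝ) < (k : ℝ) + 1 := by positivity
    refine le_of_mul_le_mul_left ?_ hk
    calc ((k : ℝ) + 1) * 16 ^ (k + 1) = 16 * ((k : ℝ) + 1) * 16 ^ k := by ring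
      _ ≤ 16 * ((k : ℝ) + 1) * (4 * k * (k.centralBinom : ℝ) ^ 2) := by gcongr
      _ = 16 * (4 * (k * ((k : ℝ) + 1))) * (k.centralBinom : ℝ) ^ 2 := by ring
      _ ≤ 16 * (2 * k + 1) ^ 2 * (k.centralBinom : ℝ) ^ 2 := by gcongr; nlinarith
      _ = 4 * (((k : ℝ) + 1) * ((k + 1).centralBinom : ℝ)) ^ 2 := by rw [h]; ring
      _ = ((k : ℝ) + 1) * (4 * ((k + 1 : ℕ) : ℝ) * ((k + 1).centralBinom : ℝ) ^ 2) := by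
        push_cast; ring

lemma centralBinom_cast_pos (k : ℕ) : (0 : ℝ) < k.centralBinom := by
  exact_mod_cast Nat.centralBinom_pos k

lemma centralBinom_mul_div_sq_le {k j : ℕ} (hk : 1 ≤ k) (hj : 1 ≤ j) :
    ((k.centralBinom : ℝ) * j.centralBinom / (k + j).centralBinom) ^ 2
      ≤ (k : ℝ)⁻¹ + (j : ℝ)⁻¹ := by
  have hk0 : (0 : ℝ) < k := by exact_mod_cast hk
  have hj0 : (0 : ℝ) < j := by exact_mod_cast hj
  have hb := centralBinom_cast_pos (k + j)
  have h : 4 * (k * j) * ((k.centralBinom : ℝ) * j.centralBinom) ^ 2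
      ≤ 4 * (k + j) * ((k + j).centralBinom : ℝ) ^ 2 := by
    calc 4 * (k * j) * ((k.centralBinom : ℝ) * j.centralBinom) ^ 2
        = (2 * k * (k.centralBinom : ℝ) ^ 2) * (2 * j * (j.centralBinom : ℝ) ^ 2) := by ring
      _ ≤ ((2 * k + 1) * (k.centralBinom : ℝ) ^ 2) *
          ((2 * j + 1) * (j.centralBinom : ℝ) ^ 2) := by gcongr <;> linarith
      _ ≤ 16 ^ k * 16 ^ j := by
        gcongr <;> exact two_mul_add_one_mul_centralBinom_sq_le _
      _ = 16 ^ (k + j) := (pow_add _ _ _).symm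
      _ ≤ 4 * (k + j) * ((k + j).centralBinom : ℝ) ^ 2 := by
        exact_mod_cast pow_le_four_mul_centralBinom_sq (le_add_right hk)
  have e : (k : ℝ)⁻¹ + (j : ℝ)⁻¹ = (k + j) / (k * j) := by field_simp; ring
  rw [e, div_pow, div_le_div_iff₀ (by positivity) (by positivity)]
  linarith

lemma tendsto_zero_of_sq_le {u v : ℕ → ℝ} (h : ∀ᶠ n in atTop, u n ^ 2 ≤ v n)
    (hv : Tendsto v atTop (nhds 0)) : Tendsto u atTop (nhds 0) := by
  have h2 : Tendsto (fun n => u n ^ 2) atTop (nhds 0) :=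
    squeeze_zero' (.of_forall fun n => sq_nonneg _) h hv
  have h3 := h2.sqrt
  simp only [Real.sqrt_sq_eq_abs, Real.sqrt_zero] at h3
  exact (tendsto_zero_iff_abs_tendsto_zero _).2 h3

lemma tendsto_centralBinom_mul_div {k j : ℕ → ℕ} (hk : Tendsto k atTop atTop)
    (hj : Tendsto j atTop atTop) :
    Tendsto (fun n => ((k n).centralBinom : ℝ) * (j n).centralBinom / (k n + j n).centralBinom)
      atTop (nhds 0) := by
  refine tendsto_zero_of_sq_le (v := fun n => (k n : ℝ)⁻¹ + (j n : ℝ)⁻¹) ?_ ?_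
  · filter_upwards [hk.eventually_ge_atTop 1, hj.eventually_ge_atTop 1] with n h1 h2
    exact centralBinom_mul_div_sq_le h1 h2
  · simpa using (tendsto_inv_atTop_nhds_zero_nat (𝕜 := ℝ).comp hk).add
      (tendsto_inv_atTop_nhds_zero_nat (𝕜 := ℝ).comp hj)

lemma tendsto_centralBinom_div_four_pow :
    Tendsto (fun n : ℕ => (n.centralBinom : ℝ) / 4 ^ n) atTop (nhds 0) := by
  refine tendsto_zero_of_sq_le (v := fun n => (n : ℝ)⁻¹) ?_ tendsto_inv_atTop_nhds_zero_nat
  filter_upwards [eventually_ge_atTop 1] with n hn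
  have hn0 : (0 : ℝ) < n := by exact_mod_cast hn
  have h := two_mul_add_one_mul_centralBinom_sq_le n
  have e : ((4 : ℝ) ^ n) ^ 2 = 16 ^ n := by rw [← pow_mul, mul_comm, pow_mul]; norm_num
  rw [div_pow, e, div_le_iff₀ (by positivity), inv_mul_eq_div, le_div_iff₀ hn0]
  nlinarith [sq_nonneg (n.centralBinom : ℝ)]

lemma tendsto_const_div_add_atTop (c d : ℝ) :
    Tendsto (fun n : ℕ => c / ((n : ℝ) + d)) atTop (nhds 0) :=
  tendsto_const_nhds.div_atTop (tendsto_atTop_add_const_right _ _ tendsto_natCast_atTop_atTop)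

lemma tendsto_choose_div_centralBinom (m : ℕ) :
    Tendsto (fun n : ℕ => ((2 * n).choose (n + m) : ℝ) / n.centralBinom) atTop (nhds 1) := by
  induction m with
  | zero =>
    refine tendsto_const_nhds.congr fun n => ?_
    rw [add_zero, ← Nat.centralBinom_eq_two_mul_choose, div_self (centralBinom_cast_pos n).ne']
  | succ m ih =>
    have h := ih.mul ((tendsto_const_div_add_atTop (2 * m + 1) (m + 1)).const_sub 1)
    rw [sub_zero, one_mul] at h
    refine h.congr' ?_
    filter_upwards [eventually_ge_atTop m] with n hn
    have hc : ((2 * n).choose (n + (m + 1)) : ℝ) * (n + (m + 1))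
        = (2 * n).choose (n + m) * (n - m) := by
      have := Nat.choose_succ_right_eq (2 * n) (n + m)
      rw [show 2 * n - (n + m) = n - m by omega] at this
      rw [← Nat.cast_sub hn]
      exact_mod_cast this
    have hp : (0 : ℝ) < n + (m + 1) := by positivity
    have hb := centralBinom_cast_pos n
    field_simp
    linear_combination -hc

lemma choose_div_centralBinom_le_one (n m : ℕ) :
    ((2 * n).choose (n + m) : ℝ) / n.centralBinom ≤ 1 := by
  rw [div_le_one (centralBinom_cast_pos n)]
  exact_mod_cast Nat.choose_le_centralBinom _ _

/-- Away from the critical point, `T_{2n}(z)` is asymptotic to `C(2n, n) / (2 - z)`. -/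
lemma tendsto_Tp_div_centralBinom {z : ℝ} (hz0 : 0 < z) (hz2 : z < 2) :
    Tendsto (fun n : ℕ => Tp n z / n.centralBinom) atTop (nhds (2 - z)⁻¹) := by
  have hw : |z - 1| < 1 := abs_lt.2 ⟨by linarith, by linarith⟩
  have h : Tendsto (fun n : ℕ =>
      ∑' m : ℕ, ((2 * n).choose (n + m) : ℝ) / n.centralBinom * (z - 1) ^ m) atTop
      (nhds (∑' m : ℕ, 1 * (z - 1) ^ m)) := by
    refine tendsto_tsum_of_dominated_convergence
      (summable_geometric_of_lt_one (abs_nonneg _) hw)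
      (fun m => (tendsto_choose_div_centralBinom m).mul_const _) (.of_forall fun n m => ?_)
    rw [Real.norm_eq_abs, abs_mul, abs_pow, abs_of_nonneg (by positivity)]
    exact mul_le_of_le_one_left (by positivity) (choose_div_centralBinom_le_one n m)
  simp only [one_mul] at h
  rw [tsum_geometric_of_abs_lt_one hw, show 1 - (z - 1) = 2 - z by ring] at h
  refine h.congr fun n => ?_
  rw [tsum_eq_sum (s := Finset.range (n + 1)), Tp, Finset.sum_div]
  · exact Finset.sum_congr rfl fun m _ => by ring
  · intro m hm
    rw [Finset.mem_range] at hm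
    rw [Nat.choose_eq_zero_of_lt (by omega)]
    simp

/-- Away from the critical point, `(n + 1) D_{2n}(z)` is asymptotic to
`C(2n, n) z / (2 - z)²`. -/
lemma tendsto_Dp_mul_div_centralBinom {z : ℝ} (hz0 : 0 < z) (hz2 : z < 2) :
    Tendsto (fun n : ℕ => Dp n z * (n + 1) / n.centralBinom) atTop
      (nhds (z / (2 - z) ^ 2)) := by
  have hw : |z - 1| < 1 := abs_lt.2 ⟨by linarith, by linarith⟩
  have hs : HasSum (fun m : ℕ => (2 * (m : ℝ) + 1) * (z - 1) ^ m) (z / (2 - z) ^ 2) := by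
    have h := ((hasSum_coe_mul_geometric_of_norm_lt_one (𝕜 := ℝ) (r := z - 1) hw).mul_left 2).add
      (hasSum_geometric_of_abs_lt_one hw)
    rw [show 1 - (z - 1) = 2 - z by ring] at h
    have hz : 2 - z ≠ 0 := by linarith
    have e : 2 * ((z - 1) / (2 - z) ^ 2) + (2 - z)⁻¹ = z / (2 - z) ^ 2 := by
      field_simp
      ring
    rw [e] at h
    simpa only [add_mul, one_mul, mul_assoc] using h
  have h : Tendsto (fun n : ℕ => ∑' m : ℕ, (2 * (m : ℝ) + 1) * (1 - m / (n + (m + 1))) *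
      (((2 * n).choose (n + m) : ℝ) / n.centralBinom) * (z - 1) ^ m) atTop
      (nhds (∑' m : ℕ, (2 * (m : ℝ) + 1) * (z - 1) ^ m)) := by
    refine tendsto_tsum_of_dominated_convergence (hs.summable.abs) (fun m => ?_)
      (.of_forall fun n m => ?_)
    · have h := (((tendsto_const_div_add_atTop m (m + 1)).const_sub 1).const_mul
        (2 * (m : ℝ) + 1)).mul (tendsto_choose_div_centralBinom m) |>.mul_const ((z - 1) ^ m)
      simpa using h
    · have h1 : (0 : ℝ) ≤ 1 - m / (n + (m + 1)) := by
        rw [sub_nonneg]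
        exact div_le_one_of_le₀ (by linarith [n.cast_nonneg (α := ℝ)]) (by positivity)
      have h2 : 1 - (m : ℝ) / (n + (m + 1)) ≤ 1 := by
        rw [sub_le_self_iff]; positivity
      have h3 := choose_div_centralBinom_le_one n m
      have h4 : (1 - (m : ℝ) / (n + (m + 1))) * (((2 * n).choose (n + m) : ℝ) / n.centralBinom)
          ≤ 1 := mul_le_one₀ h2 (by positivity) h3
      rw [Real.norm_eq_abs, mul_assoc (2 * (m : ℝ) + 1), mul_right_comm, abs_mul,
        abs_of_nonneg (a := (1 - (m : ℝ) / _) * _) (mul_nonneg h1 (by positivity))]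
      exact mul_le_of_le_one_right (abs_nonneg _) h4
  rw [hs.tsum_eq] at h
  refine h.congr fun n => ?_
  rw [tsum_eq_sum (s := Finset.range (n + 1)), Dp, Finset.sum_mul, Finset.sum_div]
  · refine Finset.sum_congr rfl fun m _ => ?_
    have hp : (0 : ℝ) < n + m + 1 := by positivity
    have hb := centralBinom_cast_pos n
    rw [← add_assoc]
    field_simp
    ring
  · intro m hm
    rw [Finset.mem_range] at hm
    rw [Nat.choose_eq_zero_of_lt (by omega)]
    simp

lemma Dp_two (n : ℕ) : Dp n 2 = n.centralBinom := by
  have h : ∀ m ∈ Finset.range (n + 1),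
      ((2 * (m : ℝ) + 1) / ((n : ℝ) + m + 1)) * (Nat.choose (2 * n) (n + m)) * (2 - 1) ^ m
        = (Nat.choose (2 * n) (n + m) : ℝ) - Nat.choose (2 * n) (n + (m + 1)) := by
    intro m hm
    have hmn : m ≤ n := by simpa [Nat.lt_succ_iff] using hm
    have hc : ((2 * n).choose (n + (m + 1)) : ℝ) * (n + m + 1)
        = (2 * n).choose (n + m) * (n - m) := by
      have := Nat.choose_succ_right_eq (2 * n) (n + m)
      rw [show 2 * n - (n + m) = n - m by omega] at this
      rw [← Nat.cast_sub hmn]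
      exact_mod_cast this
    have hp : (0 : ℝ) < n + m + 1 := by positivity
    rw [show (2 - 1 : ℝ) = 1 by norm_num, one_pow, mul_one]
    field_simp
    linear_combination hc
  rw [Dp, Finset.sum_congr rfl h,
    Finset.sum_range_sub' (fun m => (Nat.choose (2 * n) (n + m) : ℝ)),
    Nat.choose_eq_zero_of_lt (show 2 * n < n + (n + 1) by omega), add_zero,
    Nat.centralBinom_eq_two_mul_choose]
  simp

lemma Tp_two_eq (n : ℕ) :
    Tp n 2 = ((∑ m ∈ Finset.range (n + 1), (2 * n).choose (n + m) : ℕ) : ℝ) := by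
  rw [Tp]
  norm_num

lemma sum_choose_add_sum_choose (n : ℕ) :
    ∑ i ∈ Finset.range n, (2 * n).choose i +
      ∑ m ∈ Finset.range (n + 1), (2 * n).choose (n + m) = 4 ^ n := by
  rw [← Finset.sum_range_add, ← add_assoc, ← two_mul, Nat.sum_range_choose, pow_mul]
  norm_num

lemma sum_choose_reflect (n : ℕ) :
    ∑ m ∈ Finset.range (n + 1), (2 * n).choose (n + m)
      = ∑ i ∈ Finset.range (n + 1), (2 * n).choose i := by
  rw [← Finset.sum_range_reflect (fun i => (2 * n).choose i)]
  refine Finset.sum_congr rfl fun m hm => ?_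
  have hmn : m ≤ n := by simpa [Nat.lt_succ_iff] using hm
  rw [← Nat.choose_symm (show n + m ≤ 2 * n by omega)]
  congr 1
  omega

lemma Tp_two_le (n : ℕ) : Tp n 2 ≤ 4 ^ n := by
  rw [Tp_two_eq]
  exact_mod_cast (Nat.le_add_left _ _).trans (sum_choose_add_sum_choose n).le

lemma four_pow_le_Tp_two (n : ℕ) : 4 ^ n ≤ 2 * Tp n 2 := by
  rw [Tp_two_eq]
  have h1 := sum_choose_add_sum_choose n
  have h2 := sum_choose_reflect n
  rw [Finset.sum_range_succ (fun i => (2 * n).choose i) n] at h2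
  have : 4 ^ n ≤ 2 * ∑ m ∈ Finset.range (n + 1), (2 * n).choose (n + m) := by omega
  exact_mod_cast this

section Ratios

variable {k j : ℕ → ℕ}

lemma tendsto_Dp_mul_Dp_div {z : ℝ} (hz0 : 0 < z) (hz2 : z ≤ 2)
    (hk : Tendsto k atTop atTop) (hj : Tendsto j atTop atTop) :
    Tendsto (fun n => Dp (k n) z * Dp (j n) z / Dp (k n + j n) z) atTop (nhds 0) := by
  have hρ := tendsto_centralBinom_mul_div hk hj
  rcases hz2.eq_or_lt with rfl | hz2
  · simpa only [Dp_two] using hρ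
  have hD := tendsto_Dp_mul_div_centralBinom hz0 hz2
  have hL : z / (2 - z) ^ 2 ≠ 0 := by
    have : (2 - z) ≠ 0 := by linarith
    positivity
  have hq := ((hD.comp hk).mul (hD.comp hj)).div (hD.comp (tendsto_atTop_mono (fun n => Nat.le_add_right (k n) (j n)) hk)) hL
  have hbd : Tendsto (fun n => ((k n : ℝ) + j n + 1) / ((k n + 1) * (j n + 1)) *
      (((k n).centralBinom : ℝ) * (j n).centralBinom / (k n + j n).centralBinom))
      atTop (nhds 0) := by
    refine squeeze_zero (fun n => by positivity) (fun n => ?_) hρ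
    refine mul_le_of_le_one_left (by positivity) (div_le_one_of_le₀ ?_ (by positivity))
    have : (0 : ℝ) ≤ k n * j n := by positivity
    linarith
  have := hq.mul hbd
  rw [mul_zero] at this
  refine this.congr fun n => ?_
  have h1 := (centralBinom_cast_pos (k n)).ne'
  have h2 := (centralBinom_cast_pos (j n)).ne'
  have h3 := (centralBinom_cast_pos (k n + j n)).ne'
  have h4 : (k n : ℝ) + 1 ≠ 0 := by positivity
  have h5 : (j n : ℝ) + 1 ≠ 0 := by positivity
  have h6 : (k n : ℝ) + j n + 1 ≠ 0 := by positivity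
  simp only [Function.comp, Pi.div_apply, Nat.cast_add]
  by_cases h0 : Dp (k n + j n) z = 0
  · simp [h0]
  field_simp

lemma tendsto_Dp_mul_Tp_div {z : ℝ} (hz0 : 0 < z) (hz2 : z ≤ 2)
    (hk : Tendsto k atTop atTop) (hj : Tendsto j atTop atTop) :
    Tendsto (fun n => Dp (k n) z * Tp (j n) z / Tp (k n + j n) z) atTop (nhds 0) := by
  rcases hz2.eq_or_lt with rfl | hz2
  · have hT : ∀ n, 0 < Tp n 2 := fun n => by
      have := four_pow_le_Tp_two n
      have : (0 : ℝ) < 4 ^ n := by positivity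
      linarith
    have h := (tendsto_centralBinom_div_four_pow.comp hk).const_mul 2
    rw [mul_zero] at h
    refine squeeze_zero (fun n => ?_) (fun n => ?_) h
    · rw [Dp_two]
      have := hT (j n)
      have := hT (k n + j n)
      positivity
    · rw [Dp_two, div_le_iff₀ (hT _)]
      have hb := centralBinom_cast_pos (k n)
      calc ((k n).centralBinom : ℝ) * Tp (j n) 2 ≤ (k n).centralBinom * 4 ^ j n := by
            gcongr; exact Tp_two_le _
        _ = (k n).centralBinom / 4 ^ k n * 4 ^ (k n + j n) := by rw [pow_add]; field_simp
        _ ≤ (k n).centralBinom / 4 ^ k n * (2 * Tp (k n + j n) 2) := by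
            gcongr; exact four_pow_le_Tp_two _
        _ = _ := by simp only [Function.comp]; ring
  have hρ := tendsto_centralBinom_mul_div hk hj
  have hD := tendsto_Dp_mul_div_centralBinom hz0 hz2
  have hT := tendsto_Tp_div_centralBinom hz0 hz2
  have hL : (2 - z)⁻¹ ≠ 0 := inv_ne_zero (by linarith)
  have hq := ((hD.comp hk).mul (hT.comp hj)).div (hT.comp (tendsto_atTop_mono (fun n => Nat.le_add_right (k n) (j n)) hk)) hL
  have hbd : Tendsto (fun n => 1 / ((k n : ℝ) + 1) *
      (((k n).centralBinom : ℝ) * (j n).centralBinom / (k n + j n).centralBinom))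
      atTop (nhds 0) := by
    refine squeeze_zero (fun n => by positivity) (fun n => ?_) hρ
    refine mul_le_of_le_one_left (by positivity) (div_le_one_of_le₀ ?_ (by positivity))
    linarith [(k n).cast_nonneg (α := ℝ)]
  have := hq.mul hbd
  rw [mul_zero] at this
  refine this.congr fun n => ?_
  have h1 := (centralBinom_cast_pos (k n)).ne'
  have h2 := (centralBinom_cast_pos (j n)).ne'
  have h3 := (centralBinom_cast_pos (k n + j n)).ne'
  have h4 : (k n : ℝ) + 1 ≠ 0 := by positivity
  simp only [Function.comp, Pi.div_apply]
  by_cases h0 : Tp (k n + j n) z = 0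
  · simp [h0]
  field_simp

end Ratios

lemma tendsto_log_one_sub {u : ℕ → ℝ} (hu : Tendsto u atTop (nhds 0)) :
    Tendsto (fun n => Real.log (1 - u n)) atTop (nhds 0) := by
  have h := hu.const_sub 1
  rw [sub_zero] at h
  simpa using h.log one_ne_zero

/-- For `0 < z ≤ 2` and `a ∈ (0,1)`, both the Dyck path pressure and the directed path
pressure at the point `2⌊an/2⌋` vanish in the limit of long (even-length) paths. -/
theorem pressures_vanish_desorbed (z : ℝ) (hz0 : 0 < z) (hz2 : z ≤ 2)
    (a : ℝ) (ha0 : 0 < a) (ha1 : a < 1) :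
    Tendsto (fun ν : ℕ => PD ν ⌊a * (ν : ℝ)⌋₊ z) atTop (nhds 0) ∧
    Tendsto (fun ν : ℕ => PT ν ⌊a * (ν : ℝ)⌋₊ z) atTop (nhds 0) := by
  have hk : Tendsto (fun ν : ℕ => ⌊a * (ν : ℝ)⌋₊) atTop atTop :=
    tendsto_nat_floor_atTop.comp (tendsto_natCast_atTop_atTop.const_mul_atTop ha0)
  have hle : ∀ ν : ℕ, ⌊a * (ν : ℝ)⌋₊ ≤ ν := fun ν =>
    Nat.floor_le_of_le (mul_le_of_le_one_left ν.cast_nonneg ha1.le)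
  have hj : Tendsto (fun ν : ℕ => ν - ⌊a * (ν : ℝ)⌋₊) atTop atTop := by
    rw [← tendsto_natCast_atTop_iff (R := ℝ)]
    refine tendsto_atTop_mono (fun ν => ?_)
      (tendsto_natCast_atTop_atTop.const_mul_atTop (sub_pos.2 ha1))
    rw [Nat.cast_sub (hle ν)]
    linarith [Nat.floor_le (show 0 ≤ a * (ν : ℝ) by positivity)]
  have hD := tendsto_Dp_mul_Dp_div hz0 hz2 hk hj
  have hT := tendsto_Dp_mul_Tp_div hz0 hz2 hk hj
  simp only [Nat.add_sub_cancel' (hle _)] at hD hT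
  exact ⟨tendsto_log_one_sub hD, tendsto_log_one_sub hT⟩
end

section
/- At z = 2 the partition function of grafted staircase polygons constrained to pass through a given visit evaluates in closed form: for all nonnegative integers q ≤ n, Z_n^*(2;q) = Σ_{j=0}^{n} C_q(2;j)·C_{n−q}(2;j) = 2·(n(3q+2) − 3q² + 1)·catalan(q)·catalan(n−q)·(2n)!/(n!·(n+2)!). -/
open Filter Real

/-- Partition function `C_n(z;j)` of a pair of mutually avoiding directed paths of length `2n`
(an adsorbing Dyck path below a directed path whose endpoint has height `2j+2`). -/
noncomputable def Cst (n j : ℕ) (z : ℝ) : ℝ :=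
  ∑ m1 ∈ Finset.range (n + 1), ∑ m2 ∈ Finset.range (j + 1),
    (((2 * (m2 : ℝ) + 1) * (2 * (m1 : ℝ) + 2 * j + 3) * ((m1 : ℝ) + m2 + j + 2) *
        ((m1 : ℝ) - m2 + j + 1)) /
      ((2 * (n : ℝ) + 1) * (2 * (n : ℝ) + 2) * (2 * (n : ℝ) + 3) ^ 2)) *
    (Nat.choose (2 * n + 3) (n + m2 + 2)) * (Nat.choose (2 * n + 3) (n + m1 + j + 3)) *
    (z - 1) ^ (m1 + m2)

/-- Partition function `Z_n^*(z;q) = Σ_{j=0}^{n} C_q(z;j)·C_{n−q}(z;j)` of grafted staircase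
polygons constrained to pass through the visit `(q,0)`. -/
noncomputable def Zstar (n q : ℕ) (z : ℝ) : ℝ :=
  ∑ j ∈ Finset.range (n + 1), Cst q j z * Cst (n - q) j z

/-- Staircase-polygon pressure `P_n^S(z;q) = log(1 − Z_n^*(z;q)/C_n(z;0))`. -/
noncomputable def PS (n q : ℕ) (z : ℝ) : ℝ :=
  Real.log (1 - Zstar n q z / Cst n 0 z)

open Finset in
/-- Vandermonde's identity at the centre, folded about the middle index. -/
theorem centralBinom_add_eq_folded_sum (Q P M : ℕ) (hQ : Q ≤ M) (hP : P ≤ M) :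
    (Nat.centralBinom (Q + P) : ℝ) = Nat.centralBinom Q * Nat.centralBinom P +
      2 * ∑ m ∈ range M, ((2 * Q).choose (Q + (m + 1)) : ℝ) * (2 * P).choose (P + (m + 1)) := by
  have extend : ∀ R, R ≤ M → (R = Q ∨ R = P) →
      ∑ m ∈ range R, (2 * Q).choose (Q + (m + 1)) * (2 * P).choose (P + (m + 1)) =
      ∑ m ∈ range M, (2 * Q).choose (Q + (m + 1)) * (2 * P).choose (P + (m + 1)) := by
    intro R hR h
    refine sum_subset (range_subset_range.2 hR) fun m _ hm => ?_
    simp only [mem_range, not_lt] at hm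
    rcases h with rfl | rfl
    · rw [Nat.choose_eq_zero_of_lt (by omega), zero_mul]
    · rw [Nat.choose_eq_zero_of_lt (n := 2 * R) (by omega), mul_zero]
  have lower : ∑ i ∈ range Q, (2 * Q).choose i * (2 * P).choose (Q + P - i) =
      ∑ m ∈ range Q, (2 * Q).choose (Q + (m + 1)) * (2 * P).choose (P + (m + 1)) := by
    rw [← sum_range_reflect]
    refine sum_congr rfl fun m hm => ?_
    have hm := mem_range.1 hm
    rw [← Nat.choose_symm (n := 2 * Q) (k := Q + (m + 1)) (by omega)]
    congr 2 <;> omega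
  have upper : ∑ m ∈ range P, (2 * Q).choose (Q + (m + 1)) *
        (2 * P).choose (Q + P - (Q + (m + 1))) =
      ∑ m ∈ range P, (2 * Q).choose (Q + (m + 1)) * (2 * P).choose (P + (m + 1)) := by
    refine sum_congr rfl fun m hm => ?_
    have hm := mem_range.1 hm
    rw [← Nat.choose_symm (n := 2 * P) (k := P + (m + 1)) (by omega)]
    congr 2; omega
  have key : Nat.centralBinom (Q + P) = Nat.centralBinom Q * Nat.centralBinom P +
      2 * ∑ m ∈ range M, (2 * Q).choose (Q + (m + 1)) * (2 * P).choose (P + (m + 1)) := by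
    have vandermonde := Nat.add_choose_eq (2 * Q) (2 * P) (Q + P)
    rw [Finset.Nat.sum_antidiagonal_eq_sum_range_succ
      (fun i j => (2 * Q).choose i * (2 * P).choose j), Nat.succ_eq_add_one,
      show Q + P + 1 = Q + (P + 1) by ring, sum_range_add, sum_range_succ', lower, upper,
      extend Q hQ (.inl rfl), extend P hP (.inr rfl)] at vandermonde
    simp only [Nat.centralBinom, Nat.mul_add, vandermonde, add_zero, Nat.add_sub_cancel_left]
    ring
  exact_mod_cast key

theorem sq_sub_sq_mul_choose (Q m : ℕ) :
    (((Q : ℝ) + 1) ^ 2 - (m : ℝ) ^ 2) * ((2 * (Q + 1)).choose (Q + 1 + m) : ℝ) =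
      (2 * Q + 2) * (2 * Q + 1) * ((2 * Q).choose (Q + m) : ℝ) := by
  rcases lt_or_ge (Q + 1) m with h | h
  · rw [Nat.choose_eq_zero_of_lt (by omega), Nat.choose_eq_zero_of_lt (n := 2 * Q) (by omega)]
    simp
  · have outer := Nat.add_one_mul_choose_eq (2 * Q + 1) (Q + m)
    have inner := Nat.choose_mul_succ_eq (2 * Q) (Q + m)
    rw [show 2 * Q + 1 - (Q + m) = Q + 1 - m by omega] at inner
    rw [show 2 * (Q + 1) = 2 * Q + 1 + 1 by ring, show Q + 1 + m = Q + m + 1 by ring]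
    have outer' := congrArg (Nat.cast : ℕ → ℝ) outer
    have inner' := congrArg (Nat.cast : ℕ → ℝ) inner
    push_cast [Nat.cast_sub h] at outer' inner'
    linear_combination (-(Q + 1 - m : ℝ)) * outer' - (2 * Q + 2 : ℝ) * inner'

theorem centralBinom_succ_cast (n : ℕ) :
    ((n : ℝ) + 1) * Nat.centralBinom (n + 1) = 2 * (2 * n + 1) * Nat.centralBinom n := by
  exact_mod_cast Nat.succ_mul_centralBinom_succ n

open Finset in
/-- Fourth moment of a product of two symmetric binomial distributions. -/
theorem sum_pow_four_mul_choose_mul_choose (q p : ℕ) :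
    2 * ∑ m ∈ range (q + p + 1), ((m : ℝ) + 1) ^ 4 *
        ((2 * (q + 1)).choose (q + 1 + (m + 1)) : ℝ) * (2 * (p + 1)).choose (p + 1 + (m + 1)) =
      ((q : ℝ) + 1) ^ 2 * (p + 1) ^ 2 * Nat.centralBinom (q + p + 2) -
      ((p + 1) ^ 2 * (2 * q + 2) * (2 * q + 1) + (q + 1) ^ 2 * (2 * p + 2) * (2 * p + 1)) *
        Nat.centralBinom (q + p + 1) +
      (2 * q + 2) * (2 * q + 1) * (2 * p + 2) * (2 * p + 1) * Nat.centralBinom (q + p) := by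
  have v0 := centralBinom_add_eq_folded_sum (q + 1) (p + 1) (q + p + 1) (by omega) (by omega)
  have v1 := centralBinom_add_eq_folded_sum q (p + 1) (q + p + 1) (by omega) (by omega)
  have v2 := centralBinom_add_eq_folded_sum (q + 1) p (q + p + 1) (by omega) (by omega)
  have v3 := centralBinom_add_eq_folded_sum q p (q + p + 1) (by omega) (by omega)
  rw [show q + 1 + (p + 1) = q + p + 2 by ring] at v0
  rw [show q + (p + 1) = q + p + 1 by ring] at v1
  rw [show q + 1 + p = q + p + 1 by ring] at v2
  have moment : ∑ m ∈ range (q + p + 1), ((m : ℝ) + 1) ^ 4 *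
        ((2 * (q + 1)).choose (q + 1 + (m + 1)) : ℝ) * (2 * (p + 1)).choose (p + 1 + (m + 1)) =
      ((q : ℝ) + 1) ^ 2 * (p + 1) ^ 2 * (∑ m ∈ range (q + p + 1),
        ((2 * (q + 1)).choose (q + 1 + (m + 1)) : ℝ) * (2 * (p + 1)).choose (p + 1 + (m + 1))) -
      (p + 1) ^ 2 * ((2 * q + 2) * (2 * q + 1)) * (∑ m ∈ range (q + p + 1),
        ((2 * q).choose (q + (m + 1)) : ℝ) * (2 * (p + 1)).choose (p + 1 + (m + 1))) -
      (q + 1) ^ 2 * ((2 * p + 2) * (2 * p + 1)) * (∑ m ∈ range (q + p + 1),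
        ((2 * (q + 1)).choose (q + 1 + (m + 1)) : ℝ) * (2 * p).choose (p + (m + 1))) +
      (2 * q + 2) * (2 * q + 1) * ((2 * p + 2) * (2 * p + 1)) * (∑ m ∈ range (q + p + 1),
        ((2 * q).choose (q + (m + 1)) : ℝ) * (2 * p).choose (p + (m + 1))) := by
    simp only [mul_sum, ← sum_sub_distrib, ← sum_add_distrib]
    refine sum_congr rfl fun m _ => ?_
    have hq := sq_sub_sq_mul_choose q (m + 1)
    have hp := sq_sub_sq_mul_choose p (m + 1)
    push_cast at hq hp
    generalize ((2 * (q + 1)).choose (q + 1 + (m + 1)) : ℝ) = x at *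
    generalize ((2 * (p + 1)).choose (p + 1 + (m + 1)) : ℝ) = y at *
    generalize ((2 * q).choose (q + (m + 1)) : ℝ) = u at *
    generalize ((2 * p).choose (p + (m + 1)) : ℝ) = v at *
    linear_combination (-((p : ℝ) + 1) ^ 2 * y + (2 * p + 2) * (2 * p + 1) * v) * hq +
      (-((q : ℝ) + 1) ^ 2 * x + (((q : ℝ) + 1) ^ 2 - (m + 1) ^ 2) * x) * hp
  have cq := centralBinom_succ_cast q
  have cp := centralBinom_succ_cast p
  rw [moment]
  generalize (Nat.centralBinom (q + 1) : ℝ) = x at *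
  generalize (Nat.centralBinom (p + 1) : ℝ) = y at *
  generalize (Nat.centralBinom q : ℝ) = u at *
  generalize (Nat.centralBinom p : ℝ) = v at *
  linear_combination (-((q : ℝ) + 1) ^ 2 * (p + 1) ^ 2) * v0 +
    ((p : ℝ) + 1) ^ 2 * ((2 * q + 2) * (2 * q + 1)) * v1 +
    ((q : ℝ) + 1) ^ 2 * ((2 * p + 2) * (2 * p + 1)) * v2 -
    (2 * q + 2) * (2 * q + 1) * ((2 * p + 2) * (2 * p + 1)) * v3 +
    (-((q : ℝ) + 1) * (p + 1) ^ 2 * y + (q + 1) * (p + 1) * (2 * (2 * p + 1)) * v) * cq +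
    (-((p : ℝ) + 1) * (q + 1) ^ 2 * x + (q + 1) ^ 2 * (p + 1) * x) * cp

open Finset in
theorem sum_odd_mul_choose (n J : ℕ) :
    ∑ a ∈ range J, (2 * (a : ℝ) + 1) * ((2 * n + 3).choose (n + a + 2) : ℝ) =
      (2 * n + 3) * (((2 * n + 2).choose (n + 1) : ℝ) - (2 * n + 2).choose (n + 1 + J)) := by
  induction J with
  | zero => simp
  | succ a ih =>
    have absorb := congrArg (Nat.cast : ℕ → ℝ)
      (Nat.add_one_mul_choose_eq (2 * n + 2) (n + 1 + a))
    have pascal := congrArg (Nat.cast : ℕ → ℝ) (Nat.choose_succ_succ (2 * n + 2) (n + 1 + a))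
    simp only [Nat.succ_eq_add_one] at pascal
    rw [sum_range_succ, ih, show n + a + 2 = n + 1 + a + 1 by ring,
      show n + 1 + (a + 1) = n + 1 + a + 1 by ring]
    push_cast at absorb pascal
    linear_combination (-2 : ℝ) * absorb - (2 * n + 3 : ℝ) * pascal

open Finset in
theorem sum_cubic_mul_choose (n J : ℕ) :
    ∑ a ∈ range J, (a : ℝ) * (a + 1) * (2 * (a : ℝ) + 1) *
        ((2 * n + 3).choose (n + a + 2) : ℝ) =
      (2 * n + 3) * ((n + 1) * ((2 * n + 2).choose (n + 1) : ℝ) -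
        ((J : ℝ) ^ 2 + n + 1) * (2 * n + 2).choose (n + 1 + J)) := by
  induction J with
  | zero => simp
  | succ a ih =>
    have absorb := congrArg (Nat.cast : ℕ → ℝ)
      (Nat.add_one_mul_choose_eq (2 * n + 2) (n + 1 + a))
    have pascal := congrArg (Nat.cast : ℕ → ℝ) (Nat.choose_succ_succ (2 * n + 2) (n + 1 + a))
    simp only [Nat.succ_eq_add_one] at pascal
    rw [sum_range_succ, ih, show n + a + 2 = n + 1 + a + 1 by ring,
      show n + 1 + (a + 1) = n + 1 + a + 1 by ring]
    push_cast at absorb pascal ⊢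
    linear_combination (-((a : ℝ) ^ 2 + (a + 1) ^ 2 + 2 * (n + 1))) * absorb -
      (2 * n + 3 : ℝ) * ((a + 1) ^ 2 + n + 1) * pascal

open Finset in
theorem Cst_two (n j : ℕ) :
    Cst n j 2 = (catalan n : ℝ) * ((j : ℝ) + 1) ^ 2 *
      (2 * (n + 1)).choose (n + 1 + (j + 1)) / (n + 1) := by
  have hlow1 := sum_odd_mul_choose n (j + 1)
  have hlow3 := sum_cubic_mul_choose n (j + 1)
  have hall1 := sum_odd_mul_choose n (j + 1 + (n + 1))
  have hall3 := sum_cubic_mul_choose n (j + 1 + (n + 1))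
  rw [sum_range_add, hlow1, Nat.choose_eq_zero_of_lt
    (show 2 * n + 2 < n + 1 + (j + 1 + (n + 1)) by omega)] at hall1
  rw [sum_range_add, hlow3, Nat.choose_eq_zero_of_lt
    (show 2 * n + 2 < n + 1 + (j + 1 + (n + 1)) by omega)] at hall3
  have factored : Cst n j 2 =
      ((∑ b ∈ range (n + 1), (((j + 1 + b : ℕ) : ℝ)) * ((j + 1 + b : ℕ) + 1) *
          (2 * ((j + 1 + b : ℕ) : ℝ) + 1) * ((2 * n + 3).choose (n + (j + 1 + b) + 2) : ℝ)) *
        (∑ a ∈ range (j + 1), (2 * (a : ℝ) + 1) * ((2 * n + 3).choose (n + a + 2) : ℝ)) -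
       (∑ b ∈ range (n + 1), (2 * ((j + 1 + b : ℕ) : ℝ) + 1) *
          ((2 * n + 3).choose (n + (j + 1 + b) + 2) : ℝ)) *
        (∑ a ∈ range (j + 1), (a : ℝ) * (a + 1) * (2 * (a : ℝ) + 1) *
          ((2 * n + 3).choose (n + a + 2) : ℝ))) /
      ((2 * (n : ℝ) + 1) * (2 * (n : ℝ) + 2) * (2 * (n : ℝ) + 3) ^ 2) := by
    rw [Cst, sum_mul_sum, sum_mul_sum, ← sum_sub_distrib, sum_div]
    refine sum_congr rfl fun b _ => ?_
    rw [← sum_sub_distrib, sum_div]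
    refine sum_congr rfl fun a _ => ?_
    rw [show n + (j + 1 + b) + 2 = n + b + j + 3 by ring, show (2 : ℝ) - 1 = 1 by norm_num,
      one_pow]
    push_cast
    ring
  have hcat : ((n : ℝ) + 1) * catalan n = Nat.centralBinom n := by
    exact_mod_cast succ_mul_catalan_eq_centralBinom n
  have hcen := centralBinom_succ_cast n
  rw [Nat.centralBinom, show 2 * (n + 1) = 2 * n + 2 by ring] at hcen
  rw [factored, eq_sub_of_add_eq' hall1, eq_sub_of_add_eq' hall3, hlow1, hlow3,
    show 2 * (n + 1) = 2 * n + 2 by ring]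
  have hn : (n : ℝ) + 1 ≠ 0 := by positivity
  have hmid : ((2 * n + 2).choose (n + 1) : ℝ) = 2 * (2 * n + 1) * catalan n := by
    apply mul_left_cancel₀ hn
    rw [hcen, ← hcat]
    ring
  rw [hmid]
  push_cast
  field_simp
  ring

/-- Closed form at `z = 2` for the partition function of grafted staircase polygons
constrained to pass through the visit `(q,0)`:
`Z_n^*(2;q) = 2(n(3q+2) − 3q² + 1)·catalan(q)·catalan(n−q)·(2n)!/(n!·(n+2)!)`. -/
theorem staircase_through_visit_at_critical_point (n q : ℕ) (hq : q ≤ n) :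
    Zstar n q 2 = 2 * ((n : ℝ) * (3 * q + 2) - 3 * (q : ℝ) ^ 2 + 1) *
      (catalan q) * (catalan (n - q)) *
      (Nat.factorial (2 * n)) / ((Nat.factorial n) * (Nat.factorial (n + 2))) := by
  obtain ⟨p, rfl⟩ := Nat.exists_eq_add_of_le hq
  rw [Nat.add_sub_cancel_left]
  have moment := sum_pow_four_mul_choose_mul_choose q p
  have c1 := centralBinom_succ_cast (q + p)
  have c2 := centralBinom_succ_cast (q + p + 1)
  have c0 : (Nat.factorial (2 * (q + p)) : ℝ) =
      Nat.centralBinom (q + p) * (Nat.factorial (q + p)) ^ 2 := by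
    have h := Nat.choose_mul_factorial_mul_factorial
      (show q + p ≤ 2 * (q + p) by omega)
    rw [show 2 * (q + p) - (q + p) = q + p by omega] at h
    rw [← h, Nat.centralBinom]
    push_cast
    ring
  have hZ : Zstar (q + p) q 2 = (catalan q : ℝ) * catalan p / ((q + 1) * (p + 1)) *
      ∑ m ∈ Finset.range (q + p + 1), ((m : ℝ) + 1) ^ 4 *
        ((2 * (q + 1)).choose (q + 1 + (m + 1)) : ℝ) *
          (2 * (p + 1)).choose (p + 1 + (m + 1)) := by
    rw [Zstar, Nat.add_sub_cancel_left, Finset.mul_sum]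
    refine Finset.sum_congr rfl fun j _ => ?_
    rw [Cst_two, Cst_two]
    field_simp
  rw [hZ, c0, Nat.factorial_succ, Nat.factorial_succ, ← mul_right_inj' (two_ne_zero' ℝ),
    mul_left_comm, moment]
  push_cast at c1 c2 ⊢
  have h1 : (Nat.centralBinom (q + p + 1) : ℝ) =
      2 * (2 * (q + p) + 1) * Nat.centralBinom (q + p) / (q + p + 1) := by
    rw [eq_div_iff (by positivity)]
    linear_combination c1
  have h2 : (Nat.centralBinom (q + p + 2) : ℝ) =
      2 * (2 * (q + p + 1) + 1) * Nat.centralBinom (q + p + 1) / (q + p + 2) := by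
    rw [eq_div_iff (by positivity)]
    linear_combination c2
  rw [h2, h1]
  have hf : (Nat.factorial (q + p) : ℝ) ≠ 0 := by positivity
  field_simp
  ring
end

section
/- Let z be a real number with 0 < z < 2 (desorbed phase) and let a ∈ (0,1). Then the staircase-polygon pressure satisfies lim_{n→∞} n^{3/2} · P_n^S(z; 2⌊an/2⌋) = −5z/(2·(2−z)²·√(π·a³·(1−a)³)). -/
open Filter Real

open Topology MeasureTheory

/-- The binomial coefficient `(2n+3).choose (n+2+k)`, normalised so as to converge when
`k` is of order `√n`. -/
noncomputable def scaledChoose (n k : ℕ) : ℝ :=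
  Nat.choose (2 * n + 3) (n + 2 + k) * √n / 4 ^ n

lemma scaledChoose_nonneg (n k : ℕ) : 0 ≤ scaledChoose n k := by
  unfold scaledChoose; positivity

lemma scaledChoose_eq_zero {n k : ℕ} (h : n + 2 ≤ k) : scaledChoose n k = 0 := by
  simp [scaledChoose, Nat.choose_eq_zero_of_lt (show 2 * n + 3 < n + 2 + k by omega)]

lemma scaledChoose_succ {n k : ℕ} (h : k + 1 ≤ n + 2) :
    scaledChoose n (k + 1) =
      scaledChoose n k * (((n : ℝ) + 2 - (k + 1)) / ((n : ℝ) + 2 + (k + 1))) := by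
  have h1 := Nat.choose_succ_right_eq (2 * n + 3) (n + 2 + k)
  rw [show 2 * n + 3 - (n + 2 + k) = n + 2 - (k + 1) by omega] at h1
  have h2 := congrArg (Nat.cast : ℕ → ℝ) h1
  rw [Nat.cast_mul, Nat.cast_mul, Nat.cast_sub h] at h2
  push_cast at h2
  have h3 : (n : ℝ) + 2 + (k + 1) ≠ 0 := by positivity
  unfold scaledChoose
  rw [mul_div_assoc', eq_div_iff h3]
  rw [show n + 2 + (k + 1) = n + 2 + k + 1 by ring]
  linear_combination (√(n : ℝ) / 4 ^ n) * h2

lemma tendsto_centralBinom_mul_sqrt_div :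
    Tendsto (fun n : ℕ => (Nat.centralBinom n : ℝ) * √n / 4 ^ n) atTop (𝓝 (1 / √π)) := by
  have h1 := Real.Wallis.tendsto_W_nhds_pi_div_two
  have h2 : Tendsto (fun n : ℕ => √((n : ℝ) / (2 * n + 1) / Real.Wallis.W n)) atTop
      (𝓝 (√(1 / 2 / (π / 2)))) :=
    (Stirling.tendsto_self_div_two_mul_self_add_one.div h1 (by positivity)).sqrt
  have h3 : √(1 / 2 / (π / 2)) = 1 / √π := by
    rw [show (1 / 2 / (π / 2) : ℝ) = 1 / π by field_simp, Real.sqrt_div zero_le_one,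
      Real.sqrt_one]
  rw [h3] at h2
  refine h2.congr fun n => ?_
  rw [Real.sqrt_eq_iff_mul_self_eq (by have := Real.Wallis.W_pos n; positivity) (by positivity)]
  have h4 : (n.factorial : ℝ) ≠ 0 := by positivity
  have h5 : ((2 * n).factorial : ℝ) ≠ 0 := by positivity
  have h6 : (Nat.centralBinom n : ℝ) = (2 * n).factorial / (n.factorial * n.factorial) := by
    rw [Nat.centralBinom_eq_two_mul_choose, Nat.cast_choose ℝ (by omega : n ≤ 2 * n)]
    rw [show 2 * n - n = n by omega]
  have h7 : (2 : ℝ) ^ (4 * n) = 4 ^ n * 4 ^ n := by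
    rw [← mul_pow, pow_mul]; norm_num
  rw [Real.Wallis.W_eq_factorial_ratio, h6, h7]
  have h8 : √(n : ℝ) * √n = n := Real.mul_self_sqrt (by positivity)
  field_simp
  rw [sq (√(n:ℝ)), h8]

lemma tendsto_sqrt_div_sqrt_add_two :
    Tendsto (fun n : ℕ => √(n : ℝ) / √((n + 2 : ℕ) : ℝ)) atTop (𝓝 1) := by
  have h := (tendsto_natCast_div_add_atTop (2 : ℝ)).sqrt
  rw [Real.sqrt_one] at h
  refine h.congr fun n => ?_
  rw [Real.sqrt_div (by positivity)]
  push_cast; rfl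

lemma tendsto_scaledChoose_zero :
    Tendsto (fun n : ℕ => scaledChoose n 0) atTop (𝓝 (8 / √π)) := by
  have h := (((tendsto_add_atTop_iff_nat 2).2 tendsto_centralBinom_mul_sqrt_div).mul
    tendsto_sqrt_div_sqrt_add_two).const_mul 8
  rw [show (8 : ℝ) * (1 / √π * 1) = 8 / √π by ring] at h
  refine h.congr fun n => ?_
  have h1 : (Nat.centralBinom (n + 2) : ℝ) = 2 * Nat.choose (2 * n + 3) (n + 2) := by
    have h2 := Nat.choose_succ_succ (2 * n + 3) (n + 1)
    rw [Nat.choose_symm_of_eq_add (show 2 * n + 3 = n + 1 + (n + 2) by omega)] at h2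
    rw [Nat.centralBinom_eq_two_mul_choose, show 2 * (n + 2) = (2 * n + 3).succ by omega,
      show n + 2 = (n + 1).succ by rfl, h2]
    push_cast; ring
  have h3 : √((n + 2 : ℕ) : ℝ) ≠ 0 := by positivity
  rw [h1, scaledChoose, add_zero, pow_add]
  field_simp
  norm_num [mul_comm]

lemma exists_scaledChoose_zero_le : ∃ B : ℝ, 0 ≤ B ∧ ∀ n, scaledChoose n 0 ≤ B := by
  obtain ⟨B, hB⟩ := tendsto_scaledChoose_zero.bddAbove_range
  exact ⟨B, (scaledChoose_nonneg 0 0).trans (hB ⟨0, rfl⟩), fun n => hB ⟨n, rfl⟩⟩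

lemma scaledChoose_le {n k m : ℕ} (hkm : k ≤ m) (hm : m ≤ n + 2) :
    scaledChoose n k ≤ scaledChoose n 0 * exp (-(k * (k + 1) / ((n : ℝ) + 2 + m))) := by
  induction k with
  | zero => simp
  | succ k ih =>
    have hk : (k : ℝ) + 1 ≤ m := by exact_mod_cast hkm
    have hm' : (m : ℝ) ≤ n + 2 := by exact_mod_cast hm
    have hk0 : (0 : ℝ) ≤ k := by positivity
    rw [scaledChoose_succ (hkm.trans hm)]
    have h1 : ((n : ℝ) + 2 - (k + 1)) / ((n : ℝ) + 2 + (k + 1)) ≤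
        exp (-(2 * (k + 1) / ((n : ℝ) + 2 + m))) := by
      have h2 := Real.add_one_le_exp (-(2 * ((k : ℝ) + 1) / ((n : ℝ) + 2 + m)))
      refine le_trans ?_ h2
      have h3 : 2 * ((k : ℝ) + 1) / ((n : ℝ) + 2 + m) ≤
          2 * (k + 1) / ((n : ℝ) + 2 + (k + 1)) := by gcongr
      have h4 : ((n : ℝ) + 2 - (k + 1)) / ((n : ℝ) + 2 + (k + 1)) =
          1 - 2 * (k + 1) / ((n : ℝ) + 2 + (k + 1)) := by field_simp; ring
      linarith
    calc _ ≤ (scaledChoose n 0 * exp (-(k * (k + 1) / ((n : ℝ) + 2 + m)))) *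
          exp (-(2 * (k + 1) / ((n : ℝ) + 2 + m))) := by
          refine mul_le_mul (ih (by omega)) h1 (div_nonneg (by linarith) (by positivity)) ?_
          exact mul_nonneg (scaledChoose_nonneg _ _) (exp_pos _).le
      _ = _ := by
          rw [mul_assoc, ← Real.exp_add]
          congr 2
          push_cast
          field_simp
          ring

lemma le_scaledChoose {n k m : ℕ} (hkm : k ≤ m) (hm : m < n + 2) :
    scaledChoose n 0 * exp (-(k * (k + 1) / ((n : ℝ) + 2 - m))) ≤ scaledChoose n k := by
  induction k with
  | zero => simp
  | succ k ih =>
    have hk : (k : ℝ) + 1 ≤ m := by exact_mod_cast hkm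
    have hm' : (m : ℝ) < n + 2 := by exact_mod_cast hm
    have hk0 : (0 : ℝ) ≤ k := by positivity
    have hd : 0 < (n : ℝ) + 2 - m := by linarith
    have hd' : 0 < (n : ℝ) + 2 - (k + 1) := by linarith
    rw [scaledChoose_succ (hkm.trans hm.le)]
    have h1 : exp (-(2 * (k + 1) / ((n : ℝ) + 2 - m))) ≤
        ((n : ℝ) + 2 - (k + 1)) / ((n : ℝ) + 2 + (k + 1)) := by
      have h2 := Real.add_one_le_exp (2 * ((k : ℝ) + 1) / ((n : ℝ) + 2 - m))
      rw [Real.exp_neg, ← inv_div ((n : ℝ) + 2 + (k + 1))]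
      refine inv_anti₀ (div_pos (by positivity) hd') (le_trans ?_ h2)
      have h3 : 2 * ((k : ℝ) + 1) / ((n : ℝ) + 2 - (k + 1)) ≤
          2 * (k + 1) / ((n : ℝ) + 2 - m) := by gcongr
      have h4 : ((n : ℝ) + 2 + (k + 1)) / ((n : ℝ) + 2 - (k + 1)) =
          2 * (k + 1) / ((n : ℝ) + 2 - (k + 1)) + 1 := by
        rw [div_add_one hd'.ne']; ring
      linarith
    calc _ = (scaledChoose n 0 * exp (-(k * (k + 1) / ((n : ℝ) + 2 - m)))) *
          exp (-(2 * (k + 1) / ((n : ℝ) + 2 - m))) := by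
          rw [mul_assoc, ← Real.exp_add]
          congr 2
          push_cast
          field_simp
          ring
      _ ≤ _ := mul_le_mul (ih (by omega)) h1 (exp_pos _).le (scaledChoose_nonneg _ _)

lemma scaledChoose_le_gaussian (n k : ℕ) :
    scaledChoose n k ≤ scaledChoose n 0 * exp (-((k : ℝ) ^ 2 / (2 * ((n : ℝ) + 2)))) := by
  rcases le_total (n + 2) k with h | h
  · rw [scaledChoose_eq_zero h]
    exact mul_nonneg (scaledChoose_nonneg _ _) (exp_pos _).le
  · refine (scaledChoose_le le_rfl h).trans ?_
    have h' : (k : ℝ) ≤ n + 2 := by exact_mod_cast h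
    refine mul_le_mul_of_nonneg_left (Real.exp_le_exp.2 (neg_le_neg ?_)) (scaledChoose_nonneg _ _)
    gcongr
    · nlinarith [Nat.cast_nonneg (α := ℝ) k]
    · linarith

lemma tendsto_scaledChoose {ι : Type*} {l : Filter ι} {n k : ι → ℕ} {y : ℝ}
    (hn : Tendsto n l atTop) (hk : Tendsto (fun i => (k i : ℝ) / √(n i)) l (𝓝 y)) :
    Tendsto (fun i => scaledChoose (n i) (k i)) l (𝓝 (8 / √π * exp (-y ^ 2))) := by
  have hn' : Tendsto (fun i => (n i : ℝ)) l atTop := tendsto_natCast_atTop_atTop.comp hn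
  have hs : Tendsto (fun i => √(n i : ℝ)) l atTop := tendsto_sqrt_atTop.comp hn'
  have hs0 : Tendsto (fun i => (√(n i : ℝ))⁻¹) l (𝓝 0) := tendsto_inv_atTop_zero.comp hs
  have hpos : ∀ᶠ i in l, 0 < √(n i : ℝ) := hs.eventually_gt_atTop 0
  have key : ∀ c : ℝ, Tendsto (fun i => -((k i : ℝ) / √(n i) * (k i / √(n i) + (√(n i : ℝ))⁻¹) /
      (1 + 2 * (√(n i : ℝ))⁻¹ ^ 2 + c * (k i / √(n i) * (√(n i : ℝ))⁻¹)))) l (𝓝 (-y ^ 2)) := by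
    intro c
    have h := ((hk.mul (hk.add hs0)).div (((hs0.pow 2).const_mul 2).const_add 1 |>.add
      ((hk.mul hs0).const_mul c)) (by simp)).neg
    convert! h using 2
    simp only [mul_zero, add_zero, div_one, sq]
  have rewr : ∀ c : ℝ, ∀ i, 0 < √(n i : ℝ) →
      -((k i : ℝ) / √(n i) * (k i / √(n i) + (√(n i : ℝ))⁻¹) /
      (1 + 2 * (√(n i : ℝ))⁻¹ ^ 2 + c * (k i / √(n i) * (√(n i : ℝ))⁻¹))) =
      -(k i * (k i + 1) / ((n i : ℝ) + 2 + c * k i)) := by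
    intro c i hi
    have h1 := Real.sq_sqrt (Nat.cast_nonneg (α := ℝ) (n i))
    generalize √(n i : ℝ) = s at h1 hi
    rw [← h1, show (k i : ℝ) / s * (k i / s + s⁻¹) = k i * (k i + 1) / s ^ 2 by field_simp,
      show 1 + 2 * s⁻¹ ^ 2 + c * (k i / s * s⁻¹) = (s ^ 2 + 2 + c * k i) / s ^ 2 by field_simp,
      div_div_div_cancel_right₀ (by positivity)]
  have hlt : ∀ᶠ i in l, k i < n i + 2 := by
    have h := hk.mul hs0
    rw [mul_zero] at h
    filter_upwards [h.eventually_lt_const zero_lt_one, hpos] with i hi hi0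
    rw [← div_eq_mul_inv, div_div, Real.mul_self_sqrt (by positivity),
      div_lt_one (Real.sqrt_pos.1 hi0)] at hi
    have : k i < n i := by exact_mod_cast hi
    omega
  have h0 := tendsto_scaledChoose_zero.comp hn
  refine tendsto_of_tendsto_of_tendsto_of_le_of_le'
    (h0.mul ((continuous_exp.tendsto _).comp (key (-1))))
    (h0.mul ((continuous_exp.tendsto _).comp (key 1))) ?_ ?_
  · filter_upwards [hlt, hpos] with i hi hi0
    have := le_scaledChoose le_rfl hi
    simp only [Function.comp_apply]
    rwa [rewr _ i hi0, neg_one_mul, ← sub_eq_add_neg]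
  · filter_upwards [hlt, hpos] with i hi hi0
    have := scaledChoose_le le_rfl hi.le
    simp only [Function.comp_apply]
    rwa [rewr _ i hi0, one_mul]

/-- The denominator of the weights in `Cst`, relative to its leading behaviour `16 n ^ 4`. -/
noncomputable def denRatio (n : ℕ) : ℝ :=
  (n : ℝ) ^ 4 / ((2 * (n : ℝ) + 1) * (2 * (n : ℝ) + 2) * (2 * (n : ℝ) + 3) ^ 2)

lemma denRatio_nonneg (n : ℕ) : 0 ≤ denRatio n := by unfold denRatio; positivity

lemma denRatio_le (n : ℕ) : denRatio n ≤ 1 / 16 := by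
  unfold denRatio
  rw [div_le_div_iff₀ (by positivity) (by norm_num)]
  have : (0 : ℝ) ≤ n := by positivity
  have h1 : 2 * (n : ℝ) * (2 * n) * (2 * n) ^ 2 ≤
      (2 * (n : ℝ) + 1) * (2 * (n : ℝ) + 2) * (2 * (n : ℝ) + 3) ^ 2 := by gcongr <;> linarith
  linarith

lemma tendsto_denRatio : Tendsto denRatio atTop (𝓝 (1 / 16)) := by
  have key : ∀ c : ℝ, 0 < c → Tendsto (fun n : ℕ => (n : ℝ) / (2 * n + c)) atTop (𝓝 (1 / 2)) := by
    intro c hc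
    have h := (tendsto_natCast_div_add_atTop (c / 2)).const_mul (1 / 2)
    rw [mul_one] at h
    refine h.congr fun n => ?_
    field_simp
  have h := ((key 1 one_pos).mul (key 2 two_pos)).mul ((key 3 three_pos).pow 2)
  norm_num at h
  refine h.congr fun n => ?_
  unfold denRatio
  field_simp

/-- The summand of `Cst n j z`, multiplied by `n ^ (7/2) / 16 ^ n`. -/
noncomputable def scaledTerm (z : ℝ) (n j : ℕ) (p : ℕ × ℕ) : ℝ :=
  denRatio n * ((2 * (p.2 : ℝ) + 1) * (2 * (p.1 : ℝ) + 2 * j + 3) * ((p.1 : ℝ) + p.2 + j + 2) *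
    ((p.1 : ℝ) - p.2 + j + 1) / √n ^ 3) * scaledChoose n p.2 * scaledChoose n (p.1 + j + 1) *
    (z - 1) ^ (p.1 + p.2)

/-- `Cst n j z`, multiplied by `n ^ (7/2) / 16 ^ n`. -/
noncomputable def scaledCst (z : ℝ) (n j : ℕ) : ℝ := √n ^ 7 / 16 ^ n * Cst n j z

lemma scaledCst_eq_sum (z : ℝ) {n : ℕ} (hn : 1 ≤ n) (j : ℕ) :
    scaledCst z n j =
      ∑ p ∈ Finset.range (n + 1) ×ˢ Finset.range (j + 1), scaledTerm z n j p := by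
  have hn0 : (0 : ℝ) < n := by exact_mod_cast hn
  have hs : 0 < √(n : ℝ) := Real.sqrt_pos.2 hn0
  rw [scaledCst, Cst, Finset.sum_product, Finset.mul_sum]
  refine Finset.sum_congr rfl fun m₁ _ => ?_
  rw [Finset.mul_sum]
  refine Finset.sum_congr rfl fun m₂ _ => ?_
  simp only [scaledTerm, denRatio, scaledChoose]
  rw [show n + m₂ + 2 = n + 2 + m₂ by ring, show n + m₁ + j + 3 = n + 2 + (m₁ + j + 1) by ring,
    show (n : ℝ) ^ 4 = √n ^ 8 by
      rw [show 8 = 2 * 4 by rfl, pow_mul, Real.sq_sqrt hn0.le],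
    show (16 : ℝ) ^ n = 4 ^ n * 4 ^ n by rw [← mul_pow]; norm_num]
  field_simp

lemma cube_mul_exp_le (t : ℝ) :
    t ^ 3 * exp (-(t ^ 2 / 6)) ≤ 289 * exp (-(t ^ 2 / 12)) := by
  have h1 : t ^ 3 * exp (-(t ^ 2 / 12)) ≤ 289 := by
    rw [Real.exp_neg, ← div_eq_mul_inv, div_le_iff₀ (exp_pos _)]
    have h2 := Real.quadratic_le_exp_of_nonneg (show 0 ≤ t ^ 2 / 12 by positivity)
    nlinarith [sq_nonneg (t - 1), sq_nonneg (t ^ 2 - t), sq_nonneg t, sq_nonneg (t ^ 2)]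
  calc _ = (t ^ 3 * exp (-(t ^ 2 / 12))) * exp (-(t ^ 2 / 12)) := by
        rw [mul_assoc, ← Real.exp_add]; ring_nf
    _ ≤ _ := by gcongr

lemma summable_odd_mul_geometric {r : ℝ} (hr : |r| < 1) :
    Summable fun m : ℕ => (2 * (m : ℝ) + 1) * r ^ m := by
  have h1 := (summable_choose_mul_geometric_of_norm_lt_one (r := r) 1 hr).mul_left 2
  have h2 := summable_geometric_of_norm_lt_one (x := r) hr
  refine (h1.sub h2).congr fun m => ?_
  simp
  ring

lemma summable_odd_mul_geometric_prod {r : ℝ} (hr0 : 0 ≤ r) (hr : r < 1) :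
    Summable fun p : ℕ × ℕ => (2 * (p.2 : ℝ) + 1) * r ^ (p.1 + p.2) := by
  have h := Summable.mul_of_nonneg (summable_geometric_of_lt_one hr0 hr)
    (summable_odd_mul_geometric (abs_lt.2 ⟨by linarith, hr⟩))
    (fun m => by positivity) (fun m => by positivity)
  refine h.congr fun p => ?_
  rw [pow_add]; ring

lemma tsum_odd_mul_geometric_prod {r : ℝ} (hr : |r| < 1) :
    ∑' p : ℕ × ℕ, (2 * (p.2 : ℝ) + 1) * r ^ (p.1 + p.2) = (1 + r) / (1 - r) ^ 3 := by
  have h1r : 1 - r ≠ 0 := by linarith [(abs_lt.1 hr).2]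
  have h0 := summable_geometric_of_norm_lt_one (x := r) hr
  have h1 := summable_odd_mul_geometric hr
  have h := tsum_mul_tsum_of_summable_norm h0.norm h1.norm
  have h2 : ∑' m : ℕ, (2 * (m : ℝ) + 1) * r ^ m = 2 * (1 / (1 - r) ^ 2) - (1 - r)⁻¹ := by
    rw [← tsum_geometric_of_norm_lt_one (ξ := r) hr,
      show (1 : ℝ) / (1 - r) ^ 2 = 1 / (1 - r) ^ (1 + 1) by rfl,
      ← tsum_choose_mul_geometric_of_norm_lt_one (r := r) 1 hr, ← tsum_mul_left,
      ← ((summable_choose_mul_geometric_of_norm_lt_one (r := r) 1 hr).mul_left 2).tsum_sub h0]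
    refine tsum_congr fun m => ?_
    simp
    ring
  rw [tsum_geometric_of_norm_lt_one (ξ := r) hr, h2] at h
  calc _ = ∑' p : ℕ × ℕ, r ^ p.1 * ((2 * (p.2 : ℝ) + 1) * r ^ p.2) :=
        tsum_congr fun p => by rw [pow_add]; ring
    _ = _ := h.symm
    _ = _ := by field_simp; ring

lemma exists_scaledTerm_bound : ∃ K : ℝ, 0 ≤ K ∧ ∀ (z : ℝ) (n j : ℕ) (p : ℕ × ℕ), 1 ≤ n → p.2 ≤ j →
    |scaledTerm z n j p| ≤
      K * exp (-((j : ℝ) ^ 2 / (12 * n))) * ((2 * (p.2 : ℝ) + 1) * |z - 1| ^ (p.1 + p.2)) := by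
  obtain ⟨B, hB0, hB⟩ := exists_scaledChoose_zero_le
  refine ⟨1 / 16 * 6 * 289 * B * B, by positivity, fun z n j ⟨a, b⟩ hn hp => ?_⟩
  simp only at hp
  have hn1 : (1 : ℝ) ≤ n := by exact_mod_cast hn
  have hs : 0 < √(n : ℝ) := Real.sqrt_pos.2 (by linarith)
  have hs2 : √(n : ℝ) ^ 2 = n := Real.sq_sqrt (by linarith)
  have hbj : (b : ℝ) ≤ j := by exact_mod_cast hp
  have ha : (0 : ℝ) ≤ a := by positivity
  have hb : (0 : ℝ) ≤ b := by positivity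
  have hj : (0 : ℝ) ≤ j := by positivity
  have hk : ((a + j + 1 : ℕ) : ℝ) = a + j + 1 := by push_cast; ring
  set k : ℝ := a + j + 1 with hk'
  have hk0 : 0 ≤ k := by positivity
  have hnum0 : 0 ≤ (2 * (b : ℝ) + 1) * (2 * (a : ℝ) + 2 * j + 3) * ((a : ℝ) + b + j + 2) *
      ((a : ℝ) - b + j + 1) := mul_nonneg (by positivity) (by linarith)
  have hnum : (2 * (b : ℝ) + 1) * (2 * (a : ℝ) + 2 * j + 3) * ((a : ℝ) + b + j + 2) *
      ((a : ℝ) - b + j + 1) ≤ (2 * b + 1) * (3 * k) * (2 * k) * k := by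
    gcongr <;> linarith
  have hc1 : scaledChoose n b ≤ B := by
    refine (scaledChoose_le_gaussian n b).trans (le_trans ?_ (hB n))
    exact mul_le_of_le_one_right (scaledChoose_nonneg _ _)
      (Real.exp_le_one_iff.2 (neg_nonpos.2 (by positivity)))
  have hc2 : scaledChoose n (a + j + 1) ≤ B * exp (-((k / √n) ^ 2 / 6)) := by
    refine (scaledChoose_le_gaussian n _).trans ?_
    rw [hk, div_pow, hs2, div_div]
    refine mul_le_mul (hB n) (Real.exp_le_exp.2 (neg_le_neg ?_)) (exp_pos _).le hB0
    exact div_le_div_of_nonneg_left (sq_nonneg k) (by positivity) (by linarith)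
  have hexp : (k / √n) ^ 3 * exp (-((k / √n) ^ 2 / 6)) ≤
      289 * exp (-((j : ℝ) ^ 2 / (12 * n))) := by
    refine (cube_mul_exp_le _).trans ?_
    rw [div_pow, hs2, div_div, mul_comm (n : ℝ) 12]
    gcongr
    linarith
  rw [scaledTerm, abs_mul, abs_pow, abs_of_nonneg]
  swap
  · exact mul_nonneg (mul_nonneg (mul_nonneg (denRatio_nonneg n)
      (div_nonneg hnum0 (by positivity))) (scaledChoose_nonneg _ _)) (scaledChoose_nonneg _ _)
  calc _ ≤ 1 / 16 * ((2 * b + 1) * (3 * k) * (2 * k) * k / √n ^ 3) * B *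
        (B * exp (-((k / √n) ^ 2 / 6))) * |z - 1| ^ (a + b) := by
        have := denRatio_le n
        have := denRatio_nonneg n
        have := scaledChoose_nonneg n b
        have := scaledChoose_nonneg n (a + j + 1)
        gcongr
    _ = 1 / 16 * 6 * B * B * ((k / √n) ^ 3 * exp (-((k / √n) ^ 2 / 6))) *
        ((2 * b + 1) * |z - 1| ^ (a + b)) := by
        rw [div_pow]; ring
    _ ≤ 1 / 16 * 6 * B * B * (289 * exp (-((j : ℝ) ^ 2 / (12 * n)))) *
        ((2 * b + 1) * |z - 1| ^ (a + b)) := by gcongr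
    _ = _ := by ring

lemma exists_scaledCst_bound {z : ℝ} (hz : |z - 1| < 1) : ∃ M : ℝ, 0 ≤ M ∧ ∀ n j : ℕ, 1 ≤ n →
    |scaledCst z n j| ≤ M * exp (-((j : ℝ) ^ 2 / (12 * n))) := by
  obtain ⟨K, hK0, hK⟩ := exists_scaledTerm_bound
  have hsum := summable_odd_mul_geometric_prod (abs_nonneg (z - 1)) hz
  refine ⟨K * ∑' p : ℕ × ℕ, (2 * (p.2 : ℝ) + 1) * |z - 1| ^ (p.1 + p.2),
    mul_nonneg hK0 (tsum_nonneg fun p => by positivity), fun n j hn => ?_⟩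
  rw [scaledCst_eq_sum z hn]
  calc _ ≤ ∑ p ∈ Finset.range (n + 1) ×ˢ Finset.range (j + 1), |scaledTerm z n j p| :=
        Finset.abs_sum_le_sum_abs _ _
    _ ≤ ∑ p ∈ Finset.range (n + 1) ×ˢ Finset.range (j + 1),
        K * exp (-((j : ℝ) ^ 2 / (12 * n))) * ((2 * (p.2 : ℝ) + 1) * |z - 1| ^ (p.1 + p.2)) := by
        refine Finset.sum_le_sum fun p hp => hK z n j p hn ?_
        have := (Finset.mem_product.1 hp).2
        simp at this
        omega
    _ = K * exp (-((j : ℝ) ^ 2 / (12 * n))) *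
        ∑ p ∈ Finset.range (n + 1) ×ˢ Finset.range (j + 1),
        ((2 * (p.2 : ℝ) + 1) * |z - 1| ^ (p.1 + p.2)) := by rw [Finset.mul_sum]
    _ ≤ K * exp (-((j : ℝ) ^ 2 / (12 * n))) *
        ∑' p : ℕ × ℕ, ((2 * (p.2 : ℝ) + 1) * |z - 1| ^ (p.1 + p.2)) := by
        gcongr
        exact hsum.sum_le_tsum _ fun p _ => by positivity
    _ = _ := by ring

lemma tendsto_scaledTerm (z : ℝ) (p : ℕ × ℕ) {ι : Type*} {l : Filter ι} {n j : ι → ℕ} {y : ℝ}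
    (hn : Tendsto n l atTop) (hj : Tendsto (fun i => (j i : ℝ) / √(n i)) l (𝓝 y)) :
    Tendsto (fun i => scaledTerm z (n i) (j i) p) l
      (𝓝 (8 / π * y ^ 3 * exp (-y ^ 2) * ((2 * (p.2 : ℝ) + 1) * (z - 1) ^ (p.1 + p.2)))) := by
  obtain ⟨a, b⟩ := p
  have hs : Tendsto (fun i => √(n i : ℝ)) l atTop :=
    tendsto_sqrt_atTop.comp (tendsto_natCast_atTop_atTop.comp hn)
  have hs0 : Tendsto (fun i => (√(n i : ℝ))⁻¹) l (𝓝 0) := tendsto_inv_atTop_zero.comp hs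
  have hpos : ∀ᶠ i in l, 0 < √(n i : ℝ) := hs.eventually_gt_atTop 0
  have hk : Tendsto (fun i => ((a + j i + 1 : ℕ) : ℝ) / √(n i)) l (𝓝 y) := by
    have h := hj.add (hs0.const_mul ((a : ℝ) + 1))
    rw [mul_zero, add_zero] at h
    refine h.congr fun i => ?_
    push_cast
    ring
  have hb : Tendsto (fun i => (b : ℝ) / √(n i)) l (𝓝 0) := by
    simpa [div_eq_mul_inv] using hs0.const_mul (b : ℝ)
  have hnum : Tendsto (fun i => (2 * (b : ℝ) + 1) * (2 * (a : ℝ) + 2 * j i + 3) *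
      ((a : ℝ) + b + j i + 2) * ((a : ℝ) - b + j i + 1) / √(n i) ^ 3) l
      (𝓝 ((2 * (b : ℝ) + 1) * (2 * y) * y * y)) := by
    have h1 := (((hj.const_mul 2).add (hs0.const_mul (2 * (a : ℝ) + 3))).mul
      (hj.add (hs0.const_mul ((a : ℝ) + b + 2)))).mul
      (hj.add (hs0.const_mul ((a : ℝ) - b + 1))) |>.const_mul (2 * (b : ℝ) + 1)
    simp only [mul_zero, add_zero] at h1
    convert! h1.congr' ?_ using 2
    · ring
    · filter_upwards [hpos] with i hi
      field_simp
      ring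
  have h := ((((tendsto_denRatio.comp hn).mul hnum).mul (tendsto_scaledChoose hn hb)).mul
    (tendsto_scaledChoose hn hk)).mul_const ((z - 1) ^ (a + b))
  convert! h using 2
  have hpi : √π ^ 2 = π := Real.sq_sqrt pi_pos.le
  have hpi0 : √π ≠ 0 := by positivity
  simp only [ne_eq, OfNat.ofNat_ne_zero, not_false_eq_true, zero_pow, neg_zero, Real.exp_zero]
  nth_rewrite 1 [← hpi]
  field_simp
  ring

lemma tendsto_scaledCst {z : ℝ} (hz : |z - 1| < 1) {ι : Type*} {l : Filter ι} {n j : ι → ℕ} {y : ℝ}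
    (hy : 0 < y) (hn : Tendsto n l atTop) (hj : Tendsto (fun i => (j i : ℝ) / √(n i)) l (𝓝 y)) :
    Tendsto (fun i => scaledCst z (n i) (j i)) l
      (𝓝 (8 * z / (π * (2 - z) ^ 3) * (y ^ 3 * exp (-y ^ 2)))) := by
  obtain ⟨K, hK0, hK⟩ := exists_scaledTerm_bound
  have hs : Tendsto (fun i => √(n i : ℝ)) l atTop :=
    tendsto_sqrt_atTop.comp (tendsto_natCast_atTop_atTop.comp hn)
  have hjtop : Tendsto j l atTop := by
    rw [← tendsto_natCast_atTop_iff (R := ℝ)]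
    refine (hj.pos_mul_atTop hy hs).congr' ?_
    filter_upwards [hs.eventually_gt_atTop 0] with i hi
    field_simp
  have hsum := summable_odd_mul_geometric_prod (abs_nonneg (z - 1)) hz
  have key := tendsto_tsum_of_dominated_convergence
    (f := fun i p => Set.indicator
      (↑(Finset.range (n i + 1) ×ˢ Finset.range (j i + 1)) : Set (ℕ × ℕ))
      (scaledTerm z (n i) (j i)) p) (hsum.mul_left K) (𝓕 := l)
    (g := fun p => 8 / π * y ^ 3 * exp (-y ^ 2) * ((2 * (p.2 : ℝ) + 1) * (z - 1) ^ (p.1 + p.2)))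
    ?_ ?_
  · rw [tsum_mul_left, tsum_odd_mul_geometric_prod hz] at key
    convert! key.congr' ?_ using 2
    · have : 2 - z ≠ 0 := by linarith [(abs_lt.1 hz).2]
      rw [show 1 - (z - 1) = 2 - z by ring]
      field_simp
      ring
    · filter_upwards [hn.eventually_ge_atTop 1] with i hi
      rw [scaledCst_eq_sum z hi, sum_eq_tsum_indicator]
  · intro p
    refine (tendsto_scaledTerm z p hn hj).congr' ?_
    filter_upwards [hn.eventually_ge_atTop p.1, hjtop.eventually_ge_atTop p.2] with i h1 h2
    rw [Set.indicator_of_mem]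
    simp
    omega
  · filter_upwards [hn.eventually_ge_atTop 1] with i hi p
    by_cases hp : p ∈ (↑(Finset.range (n i + 1) ×ˢ Finset.range (j i + 1)) : Set (ℕ × ℕ))
    · rw [Set.indicator_of_mem hp, Real.norm_eq_abs]
      simp at hp
      refine (hK z _ _ p hi (by omega)).trans ?_
      have : exp (-((j i : ℝ) ^ 2 / (12 * n i))) ≤ 1 :=
        Real.exp_le_one_iff.2 (neg_nonpos.2 (by positivity))
      refine mul_le_mul_of_nonneg_right ?_ (by positivity)
      exact mul_le_of_le_one_right hK0 this
    · rw [Set.indicator_of_notMem hp, norm_zero]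
      positivity

lemma tendsto_Cst_zero {z : ℝ} (hz : |z - 1| < 1) :
    Tendsto (fun n : ℕ => (n : ℝ) ^ 5 / 16 ^ n * Cst n 0 z) atTop
      (𝓝 (24 * z / (π * (2 - z) ^ 4))) := by
  obtain ⟨B, hB0, hB⟩ := exists_scaledChoose_zero_le
  have hBk : ∀ n k, scaledChoose n k ≤ B := fun n k => by
    refine (scaledChoose_le_gaussian n k).trans (le_trans ?_ (hB n))
    exact mul_le_of_le_one_right (scaledChoose_nonneg _ _)
      (Real.exp_le_one_iff.2 (neg_nonpos.2 (by positivity)))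
  set c : ℕ → ℝ := fun m => (2 * (m : ℝ) + 3) * (m + 2) * (m + 1) with hc
  have hc_eq : ∀ m, c m = 12 * ((m + 3).choose 3 : ℕ) - 6 * ((m + 2).choose 2 : ℕ) := by
    intro m
    have h2 : ((m + 2).choose 2 : ℝ) = (m + 2) * (m + 1) / 2 := by
      rw [Nat.cast_choose_two]; push_cast; ring
    have h3 : ((m + 3).choose 3 : ℝ) = (m + 3) * (m + 2) * (m + 1) / 6 := by
      have := congrArg (Nat.cast : ℕ → ℝ) (Nat.add_one_mul_choose_eq (m + 2) 2)
      push_cast at this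
      rw [h2] at this
      linarith
    rw [h2, h3]
    simp only [hc]
    ring
  have hsummable : ∀ r : ℝ, |r| < 1 → HasSum (fun m => c m * r ^ m)
      (12 * (1 / (1 - r) ^ (3 + 1)) - 6 * (1 / (1 - r) ^ (2 + 1))) := by
    intro r hr
    convert! ((hasSum_choose_mul_geometric_of_norm_lt_one (r := r) 3 hr).mul_left 12).sub
      ((hasSum_choose_mul_geometric_of_norm_lt_one (r := r) 2 hr).mul_left 6) using 2 with m
    rw [hc_eq]
    ring
  have h1 : Tendsto (fun n : ℕ => scaledChoose n 0) atTop (𝓝 (8 / √π)) :=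
    tendsto_scaledChoose_zero
  have h2 : ∀ k : ℕ, Tendsto (fun n : ℕ => scaledChoose n k) atTop (𝓝 (8 / √π)) := by
    intro k
    have := tendsto_scaledChoose (n := fun n => n) (k := fun _ => k) (y := 0) tendsto_id ?_
    · simpa using this
    · simpa [div_eq_mul_inv] using (tendsto_inv_atTop_zero.comp
        (tendsto_sqrt_atTop.comp tendsto_natCast_atTop_atTop)).const_mul (k : ℝ)
  have key := tendsto_tsum_of_dominated_convergence
    (f := fun n m => Set.indicator (↑(Finset.range (n + 1)) : Set ℕ)
      (fun m => denRatio n * scaledChoose n 0 * scaledChoose n (m + 1) * (c m * (z - 1) ^ m)) m)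
    ((hsummable |z - 1| (by rwa [abs_abs])).summable.mul_left (1 / 16 * B * B)) (𝓕 := atTop)
    (g := fun m => 1 / 16 * (8 / √π) * (8 / √π) * (c m * (z - 1) ^ m)) ?_ ?_
  · rw [tsum_mul_left, (hsummable _ hz).tsum_eq] at key
    convert! key.congr' ?_ using 2
    · have : 2 - z ≠ 0 := by linarith [(abs_lt.1 hz).2]
      have hpi : √π ^ 2 = π := Real.sq_sqrt pi_pos.le
      rw [show 1 - (z - 1) = 2 - z by ring]
      nth_rewrite 1 [← hpi]
      field_simp
      ring
    · filter_upwards [eventually_ge_atTop 1] with n hn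
      have hn0 : (0 : ℝ) ≤ n := by positivity
      rw [← sum_eq_tsum_indicator, Cst, Finset.mul_sum]
      refine Finset.sum_congr rfl fun m _ => ?_
      simp only [zero_add, Finset.sum_range_one, hc, denRatio, scaledChoose, add_zero, Nat.cast_zero]
      rw [show n + m + 3 = n + 2 + (m + 1) by ring,
        show (16 : ℝ) ^ n = 4 ^ n * 4 ^ n by rw [← mul_pow]; norm_num,
        show (n : ℝ) ^ 5 = n ^ 4 * (√n * √n) by rw [Real.mul_self_sqrt hn0]; ring]
      field_simp
      ring
  · intro m
    refine (((tendsto_denRatio.mul h1).mul (h2 (m + 1))).mul_const _).congr' ?_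
    filter_upwards [eventually_ge_atTop m] with n hn
    rw [Set.indicator_of_mem]
    simp
    omega
  · refine Eventually.of_forall fun n m => ?_
    refine (norm_indicator_le_norm_self _ _).trans ?_
    have hcm : 0 ≤ c m := by simp only [hc]; positivity
    rw [Real.norm_eq_abs, abs_mul, abs_mul (c m), abs_pow, abs_of_nonneg hcm, abs_of_nonneg
      (mul_nonneg (mul_nonneg (denRatio_nonneg _) (scaledChoose_nonneg _ _))
        (scaledChoose_nonneg _ _))]
    have := denRatio_le n
    have := denRatio_nonneg n
    have := scaledChoose_nonneg n 0
    have := scaledChoose_nonneg n (m + 1)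
    have := hBk n (m + 1)
    have := hB n
    gcongr

lemma sum_range_div_eq_integral_floor (g : ℕ → ℝ) {s : ℝ} (hs : 0 < s) (N : ℕ) :
    (∑ j ∈ Finset.range N, g j) / s = ∫ x in (0 : ℝ)..(N / s), g ⌊s * x⌋₊ := by
  have hae : ∀ j : ℕ, ∀ x ∈ Set.Ioo (j : ℝ) ((j + 1 : ℕ) : ℝ), g ⌊x⌋₊ = g j := by
    intro j x hx
    rw [(Nat.floor_eq_iff ((Nat.cast_nonneg j).trans hx.1.le)).2
      ⟨hx.1.le, by simpa using hx.2⟩]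
  have hint : ∀ j : ℕ, IntervalIntegrable (fun x : ℝ => g ⌊x⌋₊) volume j ((j + 1 : ℕ) : ℝ) := by
    intro j
    refine (intervalIntegrable_const (c := g j)).congr_uIoo fun x hx => ?_
    rw [Set.uIoo_of_le (by simp)] at hx
    exact (hae j x hx).symm
  have hval : ∀ j : ℕ, ∫ x in (j : ℝ)..((j + 1 : ℕ) : ℝ), g ⌊x⌋₊ = g j := by
    intro j
    rw [intervalIntegral.integral_of_le (by simp), integral_Ioc_eq_integral_Ioo,
      setIntegral_congr_fun measurableSet_Ioo (hae j)]
    simp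
  have hsum := intervalIntegral.sum_integral_adjacent_intervals
    (f := fun x : ℝ => g ⌊x⌋₊) (μ := volume) (a := fun j : ℕ => (j : ℝ)) (n := N)
    (fun j _ => hint j)
  simp only [hval] at hsum
  rw [intervalIntegral.integral_comp_mul_left (fun x => g ⌊x⌋₊) hs.ne', hsum, mul_zero,
    mul_div_cancel₀ _ hs.ne', Nat.cast_zero, smul_eq_mul, div_eq_inv_mul]

lemma integral_pow_six_mul_exp {c : ℝ} (hc : 0 < c) :
    ∫ x in Set.Ioi (0 : ℝ), x ^ 6 * exp (-(x ^ 2 / c)) = 15 * √π / 16 * √c ^ 7 := by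
  have h := integral_rpow_mul_exp_neg_mul_rpow (p := 2) (q := 6) (b := c⁻¹) two_pos (by norm_num)
    (inv_pos.2 hc)
  have hG : Gamma ((6 + 1) / 2) = 15 * √π / 8 := by
    have := Real.Gamma_nat_add_half 3
    norm_num [Nat.doubleFactorial] at this ⊢
    exact this
  have hp : (c⁻¹ : ℝ) ^ (-(6 + 1) / 2 : ℝ) = √c ^ 7 := by
    rw [Real.inv_rpow hc.le, ← Real.rpow_neg hc.le, Real.sqrt_eq_rpow, ← Real.rpow_natCast,
      ← Real.rpow_mul hc.le]
    norm_num
  rw [hG, hp] at h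
  rw [show 15 * √π / 16 * √c ^ 7 = √c ^ 7 * (1 / 2) * (15 * √π / 8) by ring, ← h]
  refine setIntegral_congr_fun measurableSet_Ioi fun x _ => ?_
  rw [show x ^ (6 : ℝ) = x ^ 6 by exact_mod_cast Real.rpow_natCast x 6, Real.rpow_two,
    show -(x ^ 2 / c) = -c⁻¹ * x ^ 2 by ring]

lemma tendsto_atTop_of_tendsto_div {m : ℕ → ℕ} {c : ℝ} (hc : 0 < c)
    (hm : Tendsto (fun n : ℕ => (m n : ℝ) / n) atTop (𝓝 c)) : Tendsto m atTop atTop := by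
  rw [← tendsto_natCast_atTop_iff (R := ℝ)]
  refine (hm.pos_mul_atTop hc tendsto_natCast_atTop_atTop).congr' ?_
  filter_upwards [eventually_gt_atTop 0] with n hn
  field_simp

lemma tendsto_sqrt_div_sqrt {m : ℕ → ℕ} {c : ℝ} (hc : 0 < c)
    (hm : Tendsto (fun n : ℕ => (m n : ℝ) / n) atTop (𝓝 c)) :
    Tendsto (fun n : ℕ => √(n : ℝ) / √(m n)) atTop (𝓝 (1 / √c)) := by
  have h := (hm.sqrt).inv₀ (Real.sqrt_pos.2 hc).ne'
  rw [← one_div] at h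
  refine h.congr fun n => ?_
  rw [Real.sqrt_div (by positivity), inv_div]

lemma tendsto_floor_div_sqrt {m : ℕ → ℕ} {c x : ℝ} (hc : 0 < c) (hx : 0 ≤ x)
    (hm : Tendsto (fun n : ℕ => (m n : ℝ) / n) atTop (𝓝 c)) :
    Tendsto (fun n : ℕ => (⌊√(n : ℝ) * x⌋₊ : ℝ) / √(m n)) atTop (𝓝 (x / √c)) := by
  have h1 := (tendsto_nat_floor_mul_div_atTop hx).comp
    (tendsto_sqrt_atTop.comp tendsto_natCast_atTop_atTop)
  have h2 := h1.mul (tendsto_sqrt_div_sqrt hc hm)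
  rw [mul_one_div] at h2
  refine h2.congr' ?_
  filter_upwards [eventually_gt_atTop 0] with n hn
  have : 0 < √(n : ℝ) := Real.sqrt_pos.2 (by exact_mod_cast hn)
  simp only [Function.comp_apply]
  rw [mul_comm x]
  field_simp

lemma exp_neg_floor_sq_le {s x : ℝ} (hs : 1 ≤ s) (hx : 0 ≤ x) :
    exp (-((⌊s * x⌋₊ : ℝ) ^ 2 / (12 * s ^ 2))) ≤ exp (1 / 12) * exp (-(1 / 24) * x ^ 2) := by
  rw [← Real.exp_add]
  refine Real.exp_le_exp.2 ?_
  have h1 := (Nat.lt_floor_add_one (s * x)).le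
  set j : ℝ := (⌊s * x⌋₊ : ℝ)
  have hj : 0 ≤ j := Nat.cast_nonneg _
  have h2 : x ≤ j / s + 1 := by
    rw [← sub_le_iff_le_add, le_div_iff₀ (by linarith)]
    nlinarith
  have h3 : j ^ 2 / (12 * s ^ 2) = (j / s) ^ 2 / 12 := by field_simp
  have h4 : 0 ≤ j / s := by positivity
  rw [h3]
  nlinarith [sq_nonneg (j / s - 1), mul_le_mul h2 h2 hx (by linarith)]

lemma tendsto_sum_scaledCst {z a : ℝ} (hz : |z - 1| < 1) (ha0 : 0 < a) (ha1 : a < 1) {q : ℕ → ℕ}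
    (hq : Tendsto (fun n : ℕ => (q n : ℝ) / n) atTop (𝓝 a))
    (hr : Tendsto (fun n : ℕ => ((n - q n : ℕ) : ℝ) / n) atTop (𝓝 (1 - a))) :
    Tendsto (fun n : ℕ =>
      (∑ j ∈ Finset.range (n + 1), scaledCst z (q n) j * scaledCst z (n - q n) j) / √n) atTop
      (𝓝 ((8 * z / (π * (2 - z) ^ 3)) ^ 2 / (√a ^ 3 * √(1 - a) ^ 3) *
        (15 * √π / 16 * (√a * √(1 - a)) ^ 7))) := by
  have hb0 : 0 < 1 - a := by linarith
  have hqtop := tendsto_atTop_of_tendsto_div ha0 hq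
  have hrtop := tendsto_atTop_of_tendsto_div hb0 hr
  obtain ⟨M, hM0, hM⟩ := exists_scaledCst_bound hz
  set g : ℕ → ℕ → ℝ := fun n j => scaledCst z (q n) j * scaledCst z (n - q n) j
  set F : ℕ → ℝ → ℝ := fun n => Set.indicator (Set.Ioc 0 (((n + 1 : ℕ) : ℝ) / √n))
    (fun x => g n ⌊√(n : ℝ) * x⌋₊) with hF
  have hsum : ∀ᶠ n : ℕ in atTop, ∫ x in Set.Ioi (0 : ℝ), F n x =
      (∑ j ∈ Finset.range (n + 1), g n j) / √n := by
    filter_upwards [eventually_gt_atTop 0] with n hn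
    have hs : 0 < √(n : ℝ) := Real.sqrt_pos.2 (by exact_mod_cast hn)
    rw [sum_range_div_eq_integral_floor _ hs, intervalIntegral.integral_of_le (by positivity),
      hF, setIntegral_indicator measurableSet_Ioc,
      Set.inter_eq_self_of_subset_right Set.Ioc_subset_Ioi_self]
  have hlim : ∫ x in Set.Ioi (0 : ℝ), (8 * z / (π * (2 - z) ^ 3)) ^ 2 / (√a ^ 3 * √(1 - a) ^ 3) *
      (x ^ 6 * exp (-(x ^ 2 / (a * (1 - a))))) =
      (8 * z / (π * (2 - z) ^ 3)) ^ 2 / (√a ^ 3 * √(1 - a) ^ 3) *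
        (15 * √π / 16 * (√a * √(1 - a)) ^ 7) := by
    rw [integral_const_mul, integral_pow_six_mul_exp (by positivity), Real.sqrt_mul ha0.le]
  rw [← hlim]
  refine Tendsto.congr' hsum ?_
  refine tendsto_integral_filter_of_dominated_convergence
    (fun x => M * M * (exp (1 / 12) * exp (-(1 / 24) * x ^ 2))) ?_ ?_ ?_ ?_
  · refine Eventually.of_forall fun n => Measurable.aestronglyMeasurable ?_
    exact ((measurable_from_nat (f := g n)).comp
      (Nat.measurable_floor.comp (measurable_const_mul _))).indicator measurableSet_Ioc
  · filter_upwards [hqtop.eventually_ge_atTop 1, hrtop.eventually_ge_atTop 1] with n hq1 hr1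
    filter_upwards [ae_restrict_mem measurableSet_Ioi] with x hx
    refine (norm_indicator_le_norm_self _ _).trans ?_
    have hn1 : 1 ≤ n := by omega
    have hn1' : (1 : ℝ) ≤ n := by exact_mod_cast hn1
    have hqn : (q n : ℝ) ≤ n := by exact_mod_cast (by omega : q n ≤ n)
    have hq1' : (1 : ℝ) ≤ q n := by exact_mod_cast hq1
    have h1 := hM (q n) ⌊√(n : ℝ) * x⌋₊ hq1
    have h2 := (hM (n - q n) ⌊√(n : ℝ) * x⌋₊ hr1).trans
      (mul_le_of_le_one_right hM0 (Real.exp_le_one_iff.2 (neg_nonpos.2 (by positivity))))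
    have h3 := exp_neg_floor_sq_le (Real.one_le_sqrt.2 hn1') (le_of_lt hx)
    rw [Real.sq_sqrt (by linarith)] at h3
    have h4 : exp (-((⌊√(n : ℝ) * x⌋₊ : ℝ) ^ 2 / (12 * q n))) ≤
        exp (-((⌊√(n : ℝ) * x⌋₊ : ℝ) ^ 2 / (12 * n))) := by
      refine Real.exp_le_exp.2 (neg_le_neg ?_)
      gcongr
    rw [Real.norm_eq_abs, abs_mul]
    calc _ ≤ M * exp (-((⌊√(n : ℝ) * x⌋₊ : ℝ) ^ 2 / (12 * q n))) * M :=
          mul_le_mul h1 h2 (abs_nonneg _) (by positivity)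
      _ = M * M * exp (-((⌊√(n : ℝ) * x⌋₊ : ℝ) ^ 2 / (12 * q n))) := by ring
      _ ≤ _ := by gcongr; exact h4.trans h3
  · exact (((integrable_exp_neg_mul_sq (by norm_num : (0 : ℝ) < 1 / 24)).const_mul _).const_mul
      _).integrableOn
  · filter_upwards [ae_restrict_mem measurableSet_Ioi] with x hx
    have hx' : 0 < x := hx
    have hsa : 0 < √a := Real.sqrt_pos.2 ha0
    have hsb : 0 < √(1 - a) := Real.sqrt_pos.2 hb0
    have h1 := tendsto_scaledCst hz (div_pos hx' hsa) hqtop (tendsto_floor_div_sqrt ha0 hx'.le hq)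
    have h2 := tendsto_scaledCst hz (div_pos hx' hsb) hrtop (tendsto_floor_div_sqrt hb0 hx'.le hr)
    convert! (h1.mul h2).congr' ?_ using 2
    · have he : exp (-(x ^ 2 / (a * (1 - a)))) =
          exp (-(x / √a) ^ 2) * exp (-(x / √(1 - a)) ^ 2) := by
        rw [← Real.exp_add, div_pow, div_pow, Real.sq_sqrt ha0.le, Real.sq_sqrt hb0.le]
        congr 1
        field_simp
        ring
      rw [he]
      field_simp
    · have hs : Tendsto (fun n : ℕ => √(n : ℝ)) atTop atTop :=
        tendsto_sqrt_atTop.comp tendsto_natCast_atTop_atTop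
      filter_upwards [hs.eventually_ge_atTop x, hs.eventually_gt_atTop 0] with n h3 h4
      rw [hF]
      simp only
      rw [Set.indicator_of_mem]
      refine ⟨hx', ?_⟩
      rw [le_div_iff₀ h4]
      have := Real.mul_self_sqrt (Nat.cast_nonneg (α := ℝ) n)
      push_cast
      nlinarith

lemma tendsto_mul_log_one_sub {ι : Type*} {l : Filter ι} {t R : ι → ℝ} {c : ℝ}
    (ht : Tendsto t l atTop) (h : Tendsto (fun i => t i * R i) l (𝓝 c)) :
    Tendsto (fun i => t i * Real.log (1 - R i)) l (𝓝 (-c)) := by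
  have hR : Tendsto R l (𝓝 0) := by
    refine (h.div_atTop ht).congr' ?_
    filter_upwards [ht.eventually_gt_atTop 0] with i hi
    field_simp
  have h1 : Tendsto (fun i => -(t i * R i) / (1 - R i)) l (𝓝 (-c)) := by
    have := h.neg.div (hR.const_sub 1) (by norm_num)
    rwa [sub_zero, div_one] at this
  refine tendsto_of_tendsto_of_tendsto_of_le_of_le' h1 h.neg ?_ ?_
  · filter_upwards [ht.eventually_gt_atTop 0, hR.eventually_lt_const one_pos] with i hi hi1
    have hp : 0 < 1 - R i := by linarith
    have := mul_le_mul_of_nonneg_left (Real.one_sub_inv_le_log_of_pos hp) hi.le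
    refine le_trans (le_of_eq ?_) this
    field_simp
    ring
  · filter_upwards [ht.eventually_gt_atTop 0, hR.eventually_lt_const one_pos] with i hi hi1
    have hp : 0 < 1 - R i := by linarith
    have := mul_le_mul_of_nonneg_left (Real.log_le_sub_one_of_pos hp) hi.le
    linarith

lemma tendsto_two_mul_floor_half_div {a : ℝ} (ha : 0 ≤ a) :
    Tendsto (fun n : ℕ => ((2 * ⌊a * (n : ℝ) / 2⌋₊ : ℕ) : ℝ) / n) atTop (𝓝 a) := by
  have h := ((tendsto_nat_floor_mul_div_atTop (show 0 ≤ a / 2 by positivity)).comp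
    (tendsto_natCast_atTop_atTop (R := ℝ))).const_mul 2
  rw [mul_div_cancel₀ _ two_ne_zero] at h
  refine h.congr fun n => ?_
  simp only [Function.comp_apply]
  rw [show a / 2 * (n : ℝ) = a * n / 2 by ring]
  push_cast
  ring

/-- The fraction of grafted staircase polygons passing through the visit `(q n, 0)` decays like
`n ^ (-3/2)` when `q n ~ a * n`. -/
lemma tendsto_mul_Zstar_div_Cst {z a : ℝ} (hz0 : 0 < z) (hz2 : z < 2) (ha0 : 0 < a) (ha1 : a < 1)
    {q : ℕ → ℕ} (hqn : ∀ n, q n ≤ n)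
    (hq : Tendsto (fun n : ℕ => (q n : ℝ) / n) atTop (𝓝 a)) :
    Tendsto (fun n : ℕ => (n : ℝ) ^ ((3 : ℝ) / 2) * (Zstar n (q n) z / Cst n 0 z)) atTop
      (𝓝 (5 * z / (2 * (2 - z) ^ 2 * √(π * a ^ 3 * (1 - a) ^ 3)))) := by
  have hz : |z - 1| < 1 := abs_lt.2 ⟨by linarith, by linarith⟩
  have hb0 : 0 < 1 - a := by linarith
  have hr : Tendsto (fun n : ℕ => ((n - q n : ℕ) : ℝ) / n) atTop (𝓝 (1 - a)) := by
    refine (hq.const_sub 1).congr' ?_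
    filter_upwards [eventually_gt_atTop 0] with n hn
    rw [Nat.cast_sub (hqn n)]
    field_simp
  have hC := tendsto_Cst_zero hz
  have h2z : 0 < 2 - z := by linarith
  have hC0 : 24 * z / (π * (2 - z) ^ 4) ≠ 0 := by positivity
  have h := (((tendsto_sum_scaledCst hz ha0 ha1 hq hr).div hC hC0).mul
    ((tendsto_sqrt_div_sqrt ha0 hq).pow 7)).mul ((tendsto_sqrt_div_sqrt hb0 hr).pow 7)
  convert! h.congr' ?_ using 2
  · have hsa : 0 < √a := Real.sqrt_pos.2 ha0
    have hsb : 0 < √(1 - a) := Real.sqrt_pos.2 hb0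
    have hpi : 0 < √π := Real.sqrt_pos.2 pi_pos
    have h1 : √(π * a ^ 3 * (1 - a) ^ 3) = √π * √a ^ 3 * √(1 - a) ^ 3 := by
      have hcube : ∀ t : ℝ, 0 ≤ t → √(t ^ 3) = √t ^ 3 := fun t ht => by
        rw [Real.sqrt_eq_iff_mul_self_eq (by positivity) (by positivity), ← mul_pow,
          Real.mul_self_sqrt ht]
      rw [Real.sqrt_mul (by positivity), Real.sqrt_mul pi_pos.le, hcube a ha0.le,
        hcube (1 - a) hb0.le]
    rw [h1]
    have h2 : π = √π ^ 2 := (Real.sq_sqrt pi_pos.le).symm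
    generalize √π = u at *
    rw [h2]
    field_simp
    ring
  · filter_upwards [(tendsto_atTop_of_tendsto_div ha0 hq).eventually_ge_atTop 1,
      (tendsto_atTop_of_tendsto_div hb0 hr).eventually_ge_atTop 1,
      hC.eventually_ne hC0] with n h1 h2 h3
    have hn0 : (0 : ℝ) < n := by exact_mod_cast (by omega : 0 < n)
    have hs : 0 < √(n : ℝ) := Real.sqrt_pos.2 hn0
    have hsq : 0 < √(q n : ℝ) := Real.sqrt_pos.2 (by exact_mod_cast h1)
    have hsr : 0 < √((n - q n : ℕ) : ℝ) := Real.sqrt_pos.2 (by exact_mod_cast h2)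
    have hCn : Cst n 0 z ≠ 0 := fun h => h3 (by rw [h, mul_zero])
    have hZ : ∑ j ∈ Finset.range (n + 1), scaledCst z (q n) j * scaledCst z (n - q n) j =
        √(q n : ℝ) ^ 7 * √((n - q n : ℕ) : ℝ) ^ 7 / 16 ^ n * Zstar n (q n) z := by
      rw [Zstar, Finset.mul_sum]
      refine Finset.sum_congr rfl fun j _ => ?_
      rw [scaledCst, scaledCst, show (16 : ℝ) ^ n = 16 ^ q n * 16 ^ (n - q n) by
        rw [← pow_add, Nat.add_sub_cancel' (hqn n)]]
      field_simp
    have hn5 : (n : ℝ) ^ 5 = √n ^ 10 := by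
      rw [show 10 = 2 * 5 by rfl, pow_mul, Real.sq_sqrt hn0.le]
    have hn3 : (n : ℝ) ^ ((3 : ℝ) / 2) = √n ^ 3 := by
      rw [Real.sqrt_eq_rpow, ← Real.rpow_natCast, ← Real.rpow_mul hn0.le]
      norm_num
    simp only [Pi.div_apply]
    rw [hZ, hn5, hn3]
    field_simp

/-- In the desorbed phase `0 < z < 2`, for `a ∈ (0,1)`,
`lim_{n→∞} n^{3/2} · P_n^S(z; 2⌊an/2⌋) = −5z/(2(2−z)²·√(π·a³·(1−a)³))`. -/
theorem staircase_pressure_desorbed (z : ℝ) (hz0 : 0 < z) (hz2 : z < 2)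
    (a : ℝ) (ha0 : 0 < a) (ha1 : a < 1) :
    Tendsto (fun n : ℕ => (n : ℝ) ^ ((3 : ℝ) / 2) * PS n (2 * ⌊a * (n : ℝ) / 2⌋₊) z) atTop
      (nhds (-(5 * z / (2 * (2 - z) ^ 2 * Real.sqrt (π * a ^ 3 * (1 - a) ^ 3))))) := by
  have ht : Tendsto (fun n : ℕ => (n : ℝ) ^ ((3 : ℝ) / 2)) atTop atTop :=
    (tendsto_rpow_atTop (by norm_num)).comp tendsto_natCast_atTop_atTop
  refine tendsto_mul_log_one_sub ht (tendsto_mul_Zstar_div_Cst hz0 hz2 ha0 ha1 (fun n => ?_)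
    (tendsto_two_mul_floor_half_div ha0.le))
  have h1 := Nat.floor_le (show 0 ≤ a * (n : ℝ) / 2 by positivity)
  have h2 : ((2 * ⌊a * (n : ℝ) / 2⌋₊ : ℕ) : ℝ) ≤ n := by
    push_cast
    nlinarith [Nat.cast_nonneg (α := ℝ) n]
  exact_mod_cast h2
end

section
/- Let z > 2 be a real number (adsorbed phase) and let a ∈ (0,1). Then the staircase-polygon pressure tends to a nonzero constant: lim_{n→∞} P_n^S(z; 2⌊an/2⌋) = −log(z−1). -/
open Filter Real

namespace Ballot

/-- The number of paths with `2k` steps `±1` from height `0` to height `2i` that stay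
nonnegative. -/
noncomputable def ballot (k i : ℕ) : ℝ :=
  ((2 * k).choose (k + i) : ℝ) - (2 * k).choose (k + i + 1)

theorem choose_succ_mul (n k : ℕ) :
    (n.choose (k + 1) : ℝ) * (k + 1) = n.choose k * ((n : ℝ) - k) := by
  rcases le_or_gt k n with h | h
  · have := Nat.choose_succ_right_eq n k
    rw [← Nat.cast_sub h]
    exact_mod_cast this
  · simp [Nat.choose_eq_zero_of_lt h, Nat.choose_eq_zero_of_lt (Nat.lt_succ_of_lt h)]

theorem choose_add_two_mul (n k : ℕ) :
    ((k : ℝ) + 1) * ((n : ℝ) + 1 - k) * (n + 2).choose (k + 1) =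
      ((n : ℝ) + 2) * (n + 1) * n.choose k := by
  have h1 : ((n : ℝ) + 2) * (n + 1).choose k = (n + 2).choose (k + 1) * (k + 1) := by
    have := Nat.add_one_mul_choose_eq (n + 1) k
    push_cast [← @Nat.cast_inj ℝ] at this
    linarith
  have h2 : ((n : ℝ) + 1) * n.choose k = (n + 1).choose k * ((n : ℝ) + 1 - k) := by
    rcases le_or_gt k (n + 1) with h | h
    · have := Nat.choose_mul_succ_eq n k
      have e : ((n + 1 - k : ℕ) : ℝ) = (n : ℝ) + 1 - k := by
        rw [Nat.cast_sub h]; push_cast; ring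
      rw [← e, mul_comm]
      exact_mod_cast this
    · simp [Nat.choose_eq_zero_of_lt h, Nat.choose_eq_zero_of_lt (by omega : n < k)]
  linear_combination (-((n : ℝ) + 2)) * h2 - ((n : ℝ) + 1 - k) * h1

theorem choose_add_two (n k : ℕ) :
    ((n + 2).choose (k + 2) : ℝ) = n.choose k + 2 * n.choose (k + 1) + n.choose (k + 2) := by
  have h1 := Nat.choose_succ_succ (n + 1) (k + 1)
  have h2 := Nat.choose_succ_succ n k
  have h3 := Nat.choose_succ_succ n (k + 1)
  simp only [Nat.succ_eq_add_one, add_assoc, Nat.reduceAdd] at h1 h2 h3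
  rw [h1, h2, h3]
  push_cast
  ring

theorem ballot_succ_succ (k i : ℕ) :
    ballot (k + 1) (i + 1) = ballot k i + 2 * ballot k (i + 1) + ballot k (i + 2) := by
  have h1 := choose_add_two (2 * k) (k + i)
  have h2 := choose_add_two (2 * k) (k + i + 1)
  simp only [ballot]
  rw [show 2 * (k + 1) = 2 * k + 2 by ring, show k + 1 + (i + 1) = k + i + 2 by ring,
    show k + i + 2 + 1 = k + i + 1 + 2 by ring, h1, h2]
  simp only [← add_assoc]
  rw [show k + i + 1 + 2 = k + i + 2 + 1 by ring]
  ring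

theorem ballot_succ_zero (k : ℕ) : ballot (k + 1) 0 = ballot k 0 + ballot k 1 := by
  have h1 := choose_add_two (2 * k) k
  have h2 : (2 * k + 2).choose (k + 1) = 2 * ((2 * k).choose k + (2 * k).choose (k + 1)) := by
    have hs : (2 * k + 1).choose k = (2 * k + 1).choose (k + 1) :=
      Nat.choose_symm_of_eq_add (by ring)
    have e1 : (2 * k + 2).choose (k + 1) = (2 * k + 1).choose k + (2 * k + 1).choose (k + 1) :=
      Nat.choose_succ_succ (2 * k + 1) k
    have e2 : (2 * k + 1).choose (k + 1) = (2 * k).choose k + (2 * k).choose (k + 1) :=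
      Nat.choose_succ_succ (2 * k) k
    omega
  simp only [ballot, add_zero]
  rw [mul_add_one, show k + 1 + 1 = k + 2 by ring, h1, h2]
  push_cast
  ring

theorem ballot_zero_zero : ballot 0 0 = 1 := by simp [ballot]

theorem ballot_eq_zero {k i : ℕ} (h : k < i) : ballot k i = 0 := by
  simp [ballot, Nat.choose_eq_zero_of_lt (by omega : 2 * k < k + i),
    Nat.choose_eq_zero_of_lt (by omega : 2 * k < k + i + 1)]

theorem ballot_nonneg (k i : ℕ) : 0 ≤ ballot k i := by
  induction k generalizing i with
  | zero =>
    rcases Nat.eq_zero_or_pos i with rfl | h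
    · simp [ballot_zero_zero]
    · rw [ballot_eq_zero h]
  | succ k ih =>
    cases i with
    | zero => rw [ballot_succ_zero]; exact add_nonneg (ih _) (ih _)
    | succ i =>
      rw [ballot_succ_succ]
      have := ih i
      have := ih (i + 1)
      have := ih (i + 2)
      positivity

theorem sum_ballot_le (k n : ℕ) : ∑ i ∈ Finset.range n, ballot k i ≤ 4 ^ k := by
  have h : ∑ i ∈ Finset.range n, ballot k i =
      ((2 * k).choose k : ℝ) - (2 * k).choose (k + n) := by
    have := Finset.sum_range_sub' (fun i => ((2 * k).choose (k + i) : ℝ)) n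
    simpa [ballot, add_assoc] using this
  have h4 : ((2 * k).choose k : ℝ) ≤ 4 ^ k := by
    exact_mod_cast Nat.centralBinom_le_four_pow k
  rw [h]
  have : (0 : ℝ) ≤ (2 * k).choose (k + n) := Nat.cast_nonneg _
  linarith

theorem ballot_le (k i : ℕ) : ballot k i ≤ 4 ^ k :=
  (Finset.single_le_sum (fun j _ => ballot_nonneg k j)
    (Finset.self_mem_range_succ i)).trans (sum_ballot_le k (i + 1))

theorem odd_mul_choose (n m : ℕ) :
    (2 * (m : ℝ) + 1) * (2 * n + 3).choose (n + m + 2) = (2 * n + 3) * ballot (n + 1) m := by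
  have h := choose_succ_mul (2 * n + 2) (n + m + 1)
  have hp := Nat.choose_succ_succ (2 * n + 2) (n + m + 1)
  simp only [Nat.succ_eq_add_one, add_assoc, Nat.reduceAdd] at hp h
  rw [ballot, show 2 * (n + 1) = 2 * n + 2 by ring, show n + 1 + m = n + (m + 1) by ring,
    show n + m + 2 = n + (m + 2) by ring, show n + (m + 1) + 1 = n + (m + 2) by ring, hp]
  push_cast at h ⊢
  linear_combination 2 * h

theorem odd_sq_mul_ballot (n i : ℕ) :
    (2 * (i : ℝ) + 1) ^ 2 * ballot (n + 1) i =
      (2 * n + 3) ^ 2 * ballot (n + 1) i - 4 * (2 * n + 2) * (2 * n + 1) * ballot n i := by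
  have h := choose_succ_mul (2 * n + 2) (n + i + 1)
  have h1 := choose_add_two_mul (2 * n) (n + i)
  have h2 := choose_add_two_mul (2 * n) (n + i + 1)
  simp only [ballot]
  rw [show 2 * (n + 1) = 2 * n + 2 by ring, show n + 1 + i = n + i + 1 by ring]
  push_cast at h h1 h2 ⊢
  linear_combination (-4) * h1 + 4 * h2 + 4 * h

/-- `ballot k 0` is the `k`-th Catalan number. -/
theorem succ_mul_ballot_zero (k : ℕ) : ((k : ℝ) + 1) * ballot k 0 = Nat.centralBinom k := by
  have h := choose_succ_mul (2 * k) k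
  simp only [ballot, Nat.centralBinom, add_zero]
  push_cast at h
  linear_combination -h


/-- The truncated generating function `∑_{i ≤ j} ballot k i * w ^ i`. -/
noncomputable def ballotSum (w : ℝ) (k j : ℕ) : ℝ :=
  ∑ i ∈ Finset.range (j + 1), ballot k i * w ^ i

theorem ballotSum_zero (w : ℝ) (k : ℕ) : ballotSum w k 0 = ballot k 0 := by simp [ballotSum]

theorem ballotSum_succ (w : ℝ) (k j : ℕ) :
    ballotSum w k (j + 1) = ballotSum w k j + ballot k (j + 1) * w ^ (j + 1) :=
  Finset.sum_range_succ _ _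

theorem ballotSum_of_le (w : ℝ) {k j : ℕ} (h : k ≤ j) : ballotSum w k j = ballotSum w k k := by
  induction j, h using Nat.le_induction with
  | base => rfl
  | succ j hj ih => rw [ballotSum_succ, ballot_eq_zero (by omega), ih]; ring

theorem ballotSum_nonneg {w : ℝ} (hw : 0 ≤ w) (k j : ℕ) : 0 ≤ ballotSum w k j :=
  Finset.sum_nonneg fun i _ => mul_nonneg (ballot_nonneg k i) (pow_nonneg hw i)

theorem sum_tail_eq (w : ℝ) {k n : ℕ} (j : ℕ) (h : k ≤ n + 1) :
    ∑ m ∈ Finset.range (n + 1), ballot k (m + j + 1) * w ^ (m + j + 1) =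
      ballotSum w k k - ballotSum w k j := by
  rw [← ballotSum_of_le w (by omega : k ≤ j + (n + 1)), ballotSum, ballotSum,
    show j + (n + 1) + 1 = (j + 1) + (n + 1) by ring, Finset.sum_range_add _ (j + 1),
    add_sub_cancel_left]
  exact Finset.sum_congr rfl fun m _ => by rw [show j + 1 + m = m + j + 1 by ring]

theorem Cst_summand_eq (n j m1 m2 : ℕ) :
    (((2 * (m2 : ℝ) + 1) * (2 * (m1 : ℝ) + 2 * j + 3) * ((m1 : ℝ) + m2 + j + 2) *
        ((m1 : ℝ) - m2 + j + 1)) /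
      ((2 * (n : ℝ) + 1) * (2 * (n : ℝ) + 2) * (2 * (n : ℝ) + 3) ^ 2)) *
    (Nat.choose (2 * n + 3) (n + m2 + 2)) * (Nat.choose (2 * n + 3) (n + m1 + j + 3)) =
      ballot (n + 1) (m1 + j + 1) * ballot n m2 - ballot n (m1 + j + 1) * ballot (n + 1) m2 := by
  have a1 := odd_mul_choose n m2
  have a2 := odd_mul_choose n (m1 + j + 1)
  have b1 := odd_sq_mul_ballot n m2
  have b2 := odd_sq_mul_ballot n (m1 + j + 1)
  rw [show n + (m1 + j + 1) + 2 = n + m1 + j + 3 by ring] at a2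
  have h1 : (2 * (n : ℝ) + 1) ≠ 0 := by positivity
  have h2 : (2 * (n : ℝ) + 2) ≠ 0 := by positivity
  have h3 : (2 * (n : ℝ) + 3) ≠ 0 := by positivity
  push_cast at a2 b2
  generalize ((2 * n + 3).choose (n + m1 + j + 3) : ℝ) = c2 at *
  generalize ((2 * n + 3).choose (n + m2 + 2) : ℝ) = c1 at *
  generalize ballot (n + 1) (m1 + j + 1) = y1 at *
  generalize ballot (n + 1) m2 = x1 at *
  generalize ballot n (m1 + j + 1) = y0 at *
  generalize ballot n m2 = x0 at *
  have e : (2 * (m2 : ℝ) + 1) * (2 * (m1 : ℝ) + 2 * j + 3) * ((m1 : ℝ) + m2 + j + 2) *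
        ((m1 : ℝ) - m2 + j + 1) * c1 * c2 =
      (y1 * x0 - y0 * x1) *
        ((2 * (n : ℝ) + 1) * (2 * (n : ℝ) + 2) * (2 * (n : ℝ) + 3) ^ 2) := by
    have e1 : (2 * (m2 : ℝ) + 1) * (2 * (m1 : ℝ) + 2 * j + 3) * c1 * c2 =
        (2 * n + 3) ^ 2 * (x1 * y1) := by
      linear_combination (2 * (m1 : ℝ) + 2 * j + 3) * c2 * a1 + (2 * n + 3) * x1 * a2
    linear_combination ((m1 : ℝ) + m2 + j + 2) * ((m1 : ℝ) - m2 + j + 1) * e1 +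
      (2 * (n : ℝ) + 3) ^ 2 / 4 * (x1 * b2 - y1 * b1)
  rw [div_mul_eq_mul_div, div_mul_eq_mul_div, e]
  field_simp

theorem Cst_mul_pow (n j : ℕ) (z : ℝ) :
    Cst n j z * (z - 1) ^ (j + 1) =
      ballotSum (z - 1) (n + 1) (n + 1) * ballotSum (z - 1) n j -
        ballotSum (z - 1) n n * ballotSum (z - 1) (n + 1) j := by
  have h : Cst n j z * (z - 1) ^ (j + 1) =
      (∑ m1 ∈ Finset.range (n + 1),
          ballot (n + 1) (m1 + j + 1) * (z - 1) ^ (m1 + j + 1)) * ballotSum (z - 1) n j -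
        (∑ m1 ∈ Finset.range (n + 1), ballot n (m1 + j + 1) * (z - 1) ^ (m1 + j + 1)) *
          ballotSum (z - 1) (n + 1) j := by
    rw [ballotSum, ballotSum, Finset.sum_mul_sum, Finset.sum_mul_sum, Cst, Finset.sum_mul,
      ← Finset.sum_sub_distrib]
    refine Finset.sum_congr rfl fun m1 _ => ?_
    rw [Finset.sum_mul, ← Finset.sum_sub_distrib]
    refine Finset.sum_congr rfl fun m2 _ => ?_
    rw [Cst_summand_eq]
    ring
  rw [h, sum_tail_eq _ _ le_rfl, sum_tail_eq _ _ n.le_succ]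
  ring

theorem ballotSum_succ_left {w : ℝ} (hw : w ≠ 0) (k j : ℕ) :
    ballotSum w (k + 1) j = (w + 2 + w⁻¹) * ballotSum w k j -
      w ^ (j + 1) * (ballot k j - w⁻¹ * ballot k (j + 1)) - (1 + w⁻¹) * ballot k 0 := by
  induction j with
  | zero =>
    rw [ballotSum_zero, ballotSum_zero, ballot_succ_zero]
    field_simp
    ring
  | succ j ih =>
    rw [ballotSum_succ, ballotSum_succ, ih, ballot_succ_succ]
    field_simp
    ring

theorem ballotSum_diag_succ {w : ℝ} (hw : w ≠ 0) (k : ℕ) :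
    ballotSum w (k + 1) (k + 1) =
      (w + 2 + w⁻¹) * ballotSum w k k - (1 + w⁻¹) * ballot k 0 := by
  rw [ballotSum_succ_left hw, ballotSum_of_le w k.le_succ, ballot_eq_zero (by omega : k < k + 1),
    ballot_eq_zero (by omega : k < k + 1 + 1)]
  ring

theorem ballotSum_diag_eq {w : ℝ} (hw : w ≠ 0) (k : ℕ) :
    ballotSum w k k =
      (1 - w⁻¹) * (w + 2 + w⁻¹) ^ k + w⁻¹ * ballotSum w⁻¹ k k := by
  induction k with
  | zero => simp [ballotSum_zero, ballot_zero_zero]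
  | succ k ih =>
    rw [ballotSum_diag_succ hw, ballotSum_diag_succ (inv_ne_zero hw), ih, inv_inv, pow_succ]
    generalize (w + 2 + w⁻¹) ^ k = l
    field_simp
    ring

theorem ballotSum_le_of_le_one {w : ℝ} (h0 : 0 ≤ w) (h1 : w ≤ 1) (k j : ℕ) :
    ballotSum w k j ≤ 4 ^ k :=
  (Finset.sum_le_sum fun i _ =>
    mul_le_of_le_one_right (ballot_nonneg k i) (pow_le_one₀ h0 h1)).trans (sum_ballot_le k _)

theorem ballotSum_div_pow_le {w : ℝ} (h1 : 1 ≤ w) (k j : ℕ) :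
    ballotSum w k j / w ^ j ≤ 4 ^ k := by
  rw [div_le_iff₀ (by positivity)]
  calc ballotSum w k j ≤ ∑ i ∈ Finset.range (j + 1), ballot k i * w ^ j :=
        Finset.sum_le_sum fun i hi => mul_le_mul_of_nonneg_left
          (pow_le_pow_right₀ h1 (by simpa [Nat.lt_succ_iff] using hi)) (ballot_nonneg k i)
    _ ≤ 4 ^ k * w ^ j := by
        rw [← Finset.sum_mul]
        exact mul_le_mul_of_nonneg_right (sum_ballot_le k _) (by positivity)

/-- The leading factor of `Cst k j z` in the adsorbed phase, as a function of `j`. -/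
noncomputable def profile (w : ℝ) (k j : ℕ) : ℝ :=
  ballot k j - w⁻¹ * ballot k (j + 1) + w⁻¹ * (1 + w⁻¹) * ballot k 0 * w⁻¹ ^ j

theorem Cst_eq_profile {z : ℝ} (hz : z - 1 ≠ 0) (k j : ℕ) :
    Cst k j z = ballotSum (z - 1) k k * profile (z - 1) k j -
      (z - 1)⁻¹ * (1 + (z - 1)⁻¹) * ballot k 0 *
        (ballotSum (z - 1) k j / (z - 1) ^ j) := by
  have h := Cst_mul_pow k j z
  rw [ballotSum_diag_succ hz, ballotSum_succ_left hz] at h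
  have hp : (z - 1) ^ (j + 1) ≠ 0 := pow_ne_zero _ hz
  rw [eq_div_of_mul_eq hp h, profile]
  generalize z - 1 = w at *
  rw [inv_pow]
  field_simp
  ring

theorem sum_ballot_succ_mul (q p : ℕ) {n : ℕ} (hp : p < n) :
    ∑ j ∈ Finset.range n, ballot (q + 1) j * ballot p j =
      ∑ j ∈ Finset.range n, ballot q j * ballot p (j + 1) +
        2 * ∑ j ∈ Finset.range n, ballot q j * ballot p j +
        ∑ j ∈ Finset.range n, ballot q (j + 1) * ballot p j - ballot q 0 * ballot p 0 := by
  have key : ∀ m, ∑ j ∈ Finset.range (m + 1), ballot (q + 1) j * ballot p j =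
      ∑ j ∈ Finset.range (m + 1), ballot q j * ballot p (j + 1) +
        2 * ∑ j ∈ Finset.range (m + 1), ballot q j * ballot p j +
        ∑ j ∈ Finset.range (m + 1), ballot q (j + 1) * ballot p j - ballot q 0 * ballot p 0 -
        ballot q m * ballot p (m + 1) := by
    intro m
    induction m with
    | zero => simp only [zero_add, Finset.sum_range_one, ballot_succ_zero]; ring
    | succ m ih =>
      rw [Finset.sum_range_succ, ih]
      simp only [Finset.sum_range_succ _ (m + 1), ballot_succ_succ]
      ring
  obtain ⟨m, rfl⟩ : ∃ m, n = m + 1 := ⟨n - 1, by omega⟩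
  rw [key m, ballot_eq_zero hp]
  ring

theorem sum_ballot_mul_ballot {q p n : ℕ} (h : q + p < n) :
    ∑ j ∈ Finset.range n, ballot q j * ballot p j = ballot (q + p) 0 := by
  induction q generalizing p with
  | zero =>
    obtain ⟨m, rfl⟩ : ∃ m, n = m + 1 := ⟨n - 1, by omega⟩
    rw [Finset.sum_range_succ', ballot_zero_zero]
    simp [ballot_eq_zero]
  | succ q ih =>
    rw [show q + 1 + p = q + (p + 1) by ring, ← ih (by omega), sum_ballot_succ_mul q p (by omega)]
    have := sum_ballot_succ_mul p q (by omega : q < n)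
    simp only [mul_comm (ballot q _)]
    rw [this]
    ring

theorem sum_ballot_succ_mul_ballot_succ {q p n : ℕ} (hq : q < n) :
    ∑ j ∈ Finset.range n, ballot q (j + 1) * ballot p (j + 1) =
      ∑ j ∈ Finset.range n, ballot q j * ballot p j - ballot q 0 * ballot p 0 := by
  have := Finset.sum_range_succ' (fun j => ballot q j * ballot p j) n
  rw [Finset.sum_range_succ, ballot_eq_zero hq] at this
  linarith

theorem sum_sub_shift_mul_pow (u : ℝ) {q n : ℕ} (hq : q < n) :
    ∑ j ∈ Finset.range n, (ballot q j - u * ballot q (j + 1)) * u ^ j = ballot q 0 := by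
  have := Finset.sum_range_sub' (fun j => ballot q j * u ^ j) n
  rw [ballot_eq_zero hq] at this
  rw [← sub_zero (ballot q 0)]
  convert this using 1
  · exact Finset.sum_congr rfl fun j _ => by ring
  · simp

theorem sum_profile_mul_profile {w : ℝ} (hw : w ≠ 0) {q p n : ℕ} (h : q + p < n) :
    ∑ j ∈ Finset.range n, profile w q j * profile w p j =
      w⁻¹ * ((w + 2 + w⁻¹) * ballot (q + p) 0 - ballot (q + p + 1) 0) +
        (w⁻¹ * (1 + w⁻¹) + (w⁻¹ * (1 + w⁻¹)) ^ 2 * ∑ j ∈ Finset.range n, (w⁻¹ ^ 2) ^ j) *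
          (ballot q 0 * ballot p 0) := by
  have hq : q < n := by omega
  have hp : p < n := by omega
  have h1 := sum_ballot_mul_ballot h
  have h2 : ∑ j ∈ Finset.range n, ballot (q + 1) j * ballot p j = ballot (q + p + 1) 0 := by
    rcases Nat.lt_or_ge (q + 1 + p) n with h' | h'
    · rw [sum_ballot_mul_ballot h', show q + 1 + p = q + p + 1 by ring]
    · have h'' := sum_ballot_mul_ballot (show q + 1 + p < n + 1 by omega)
      rw [Finset.sum_range_succ, ballot_eq_zero hp, mul_zero, add_zero] at h''
      rw [h'', show q + 1 + p = q + p + 1 by ring]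
  rw [sum_ballot_succ_mul q p hp, h1] at h2
  have h3 := sum_ballot_succ_mul_ballot_succ (p := p) hq
  rw [h1] at h3
  have h4 := sum_sub_shift_mul_pow w⁻¹ hq
  have h5 := sum_sub_shift_mul_pow w⁻¹ hp
  have e : ∑ j ∈ Finset.range n, profile w q j * profile w p j =
      ∑ j ∈ Finset.range n, ballot q j * ballot p j
      - w⁻¹ * (∑ j ∈ Finset.range n, ballot q j * ballot p (j + 1) +
          ∑ j ∈ Finset.range n, ballot q (j + 1) * ballot p j)
      + w⁻¹ ^ 2 * ∑ j ∈ Finset.range n, ballot q (j + 1) * ballot p (j + 1)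
      + w⁻¹ * (1 + w⁻¹) * ballot p 0 *
          ∑ j ∈ Finset.range n, (ballot q j - w⁻¹ * ballot q (j + 1)) * w⁻¹ ^ j
      + w⁻¹ * (1 + w⁻¹) * ballot q 0 *
          ∑ j ∈ Finset.range n, (ballot p j - w⁻¹ * ballot p (j + 1)) * w⁻¹ ^ j
      + (w⁻¹ * (1 + w⁻¹)) ^ 2 * (ballot q 0 * ballot p 0) *
          ∑ j ∈ Finset.range n, (w⁻¹ ^ 2) ^ j := by
    simp only [Finset.mul_sum, ← Finset.sum_add_distrib, ← Finset.sum_sub_distrib]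
    refine Finset.sum_congr rfl fun j _ => ?_
    rw [profile, profile, ← pow_mul, mul_comm 2 j, pow_mul]
    ring
  rw [e, h1, h3, h4, h5]
  have hww : w * w⁻¹ = 1 := mul_inv_cancel₀ hw
  linear_combination (-w⁻¹) * h2 - ballot (q + p) 0 * hww

theorem sum_pow_le {x : ℝ} (h0 : 0 ≤ x) (h1 : x < 1) (n : ℕ) :
    ∑ j ∈ Finset.range n, x ^ j ≤ (1 - x)⁻¹ := by
  rw [← tsum_geometric_of_lt_one h0 h1]
  exact (summable_geometric_of_lt_one h0 h1).sum_le_tsum _ fun j _ => pow_nonneg h0 j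

theorem sum_abs_profile_le {w : ℝ} (hw : 1 < w) (k n : ℕ) :
    ∑ j ∈ Finset.range n, |profile w k j| ≤ (2 + 2 * (1 - w⁻¹)⁻¹) * 4 ^ k := by
  have hu0 : 0 < w⁻¹ := by positivity
  have hu1 : w⁻¹ < 1 := inv_lt_one_of_one_lt₀ hw
  have hshift : ∑ j ∈ Finset.range n, ballot k (j + 1) ≤ 4 ^ k := by
    have := Finset.sum_range_succ' (fun j => ballot k j) n
    have h0 := ballot_nonneg k 0
    have := sum_ballot_le k (n + 1)
    linarith
  have hg : ∑ j ∈ Finset.range n, w⁻¹ ^ j ≤ (1 - w⁻¹)⁻¹ := sum_pow_le hu0.le hu1 n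
  have hpt : ∀ j, |profile w k j| ≤
      ballot k j + ballot k (j + 1) + 2 * 4 ^ k * w⁻¹ ^ j := by
    intro j
    have b0 := ballot_nonneg k j
    have b1 := ballot_nonneg k (j + 1)
    have b2 := ballot_nonneg k 0
    have b3 : w⁻¹ * ballot k (j + 1) ≤ ballot k (j + 1) := mul_le_of_le_one_left b1 hu1.le
    have b4 : 0 ≤ w⁻¹ * ballot k (j + 1) := by positivity
    have b5 : 0 ≤ w⁻¹ * (1 + w⁻¹) * ballot k 0 * w⁻¹ ^ j := by positivity
    have b6 : w⁻¹ * (1 + w⁻¹) * ballot k 0 * w⁻¹ ^ j ≤ 2 * 4 ^ k * w⁻¹ ^ j := by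
      have := ballot_le k 0
      gcongr
      nlinarith
    rw [profile, abs_le]
    constructor <;> linarith
  calc ∑ j ∈ Finset.range n, |profile w k j|
      ≤ ∑ j ∈ Finset.range n, (ballot k j + ballot k (j + 1) + 2 * 4 ^ k * w⁻¹ ^ j) :=
        Finset.sum_le_sum fun j _ => hpt j
    _ = ∑ j ∈ Finset.range n, ballot k j + ∑ j ∈ Finset.range n, ballot k (j + 1) +
          2 * 4 ^ k * ∑ j ∈ Finset.range n, w⁻¹ ^ j := by
        rw [Finset.sum_add_distrib, Finset.sum_add_distrib, Finset.mul_sum]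
    _ ≤ 4 ^ k + 4 ^ k + 2 * 4 ^ k * (1 - w⁻¹)⁻¹ := by
        gcongr
        exact sum_ballot_le k n
    _ = _ := by ring

theorem ballot_zero_pos (k : ℕ) : 0 < ballot k 0 := by
  have h := succ_mul_ballot_zero k
  have h1 : (0 : ℝ) < Nat.centralBinom k := by exact_mod_cast Nat.centralBinom_pos k
  rw [← h] at h1
  exact pos_of_mul_pos_right h1 (by positivity)

theorem four_pow_le_mul_ballot_zero (n : ℕ) : (4 : ℝ) ^ n ≤ 2 * (n + 1) ^ 2 * ballot n 0 := by
  have h : (4 : ℝ) ^ n ≤ 2 * (n + 1) * Nat.centralBinom n := by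
    rcases Nat.eq_zero_or_pos n with rfl | hn
    · norm_num
    · have : 4 ^ n ≤ 2 * (n + 1) * Nat.centralBinom n :=
        (Nat.four_pow_le_two_mul_self_mul_centralBinom n hn).trans
          (Nat.mul_le_mul_right _ (by omega))
      exact_mod_cast this
  rw [← succ_mul_ballot_zero] at h
  linarith

theorem tendsto_ballot_succ_zero_div :
    Tendsto (fun n => ballot (n + 1) 0 / ballot n 0) atTop (nhds 4) := by
  have h : ∀ n : ℕ, ballot (n + 1) 0 / ballot n 0 = 4 - 6 * (1 / ((n : ℝ) + 2)) := by
    intro n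
    have h0 := ballot_zero_pos n
    have h1 : ((n : ℝ) + 1) * Nat.centralBinom (n + 1) = 2 * (2 * n + 1) * Nat.centralBinom n := by
      exact_mod_cast Nat.succ_mul_centralBinom_succ n
    rw [← succ_mul_ballot_zero, ← succ_mul_ballot_zero] at h1
    have h2 : ((n : ℝ) + 2) * ballot (n + 1) 0 = 2 * (2 * n + 1) * ballot n 0 := by
      have hn : ((n : ℝ) + 1) ≠ 0 := by positivity
      apply mul_left_cancel₀ hn
      push_cast at h1
      linear_combination h1
    field_simp
    linear_combination h2
  have hlim : Tendsto (fun n : ℕ => 1 / ((n : ℝ) + 2)) atTop (nhds 0) := by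
    have := (tendsto_add_atTop_iff_nat 1).2 (tendsto_one_div_add_atTop_nhds_zero_nat (𝕜 := ℝ))
    refine this.congr fun n => ?_
    push_cast
    ring
  simp only [h]
  simpa using tendsto_const_nhds.sub (hlim.const_mul (6 : ℝ))

theorem sq_centralBinom_div_four_pow_le (k : ℕ) :
    ((Nat.centralBinom k : ℝ) / 4 ^ k) ^ 2 * (2 * k + 1) ≤ 1 := by
  induction k with
  | zero => simp
  | succ k ih =>
    have h1 : ((k : ℝ) + 1) * Nat.centralBinom (k + 1) = 2 * (2 * k + 1) * Nat.centralBinom k := by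
      exact_mod_cast Nat.succ_mul_centralBinom_succ k
    have h2 : (Nat.centralBinom (k + 1) : ℝ) / 4 ^ (k + 1) =
        (2 * k + 1) / (2 * (k + 1)) * ((Nat.centralBinom k : ℝ) / 4 ^ k) := by
      rw [pow_succ]
      field_simp
      linear_combination 2 * h1
    rw [h2]
    refine le_trans ?_ ih
    rw [mul_pow, div_pow, mul_comm, ← mul_assoc, mul_comm _ (2 * (k : ℝ) + 1)]
    refine mul_le_mul_of_nonneg_right ?_ (sq_nonneg _)
    rw [mul_div_assoc', div_le_iff₀ (by positivity)]
    push_cast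
    nlinarith [(Nat.cast_nonneg k : (0 : ℝ) ≤ k)]

theorem tendsto_centralBinom_div_four_pow :
    Tendsto (fun k => (Nat.centralBinom k : ℝ) / 4 ^ k) atTop (nhds 0) := by
  have hsq : Tendsto (fun k => ((Nat.centralBinom k : ℝ) / 4 ^ k) ^ 2) atTop (nhds 0) := by
    refine squeeze_zero (fun k => sq_nonneg _) (fun k => ?_)
      (tendsto_one_div_add_atTop_nhds_zero_nat (𝕜 := ℝ))
    rw [le_div_iff₀ (by positivity)]
    refine le_trans ?_ (sq_centralBinom_div_four_pow_le k)
    refine mul_le_mul_of_nonneg_left ?_ (sq_nonneg _)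
    linarith [(Nat.cast_nonneg k : (0 : ℝ) ≤ k)]
  have := hsq.sqrt
  simp only [Real.sqrt_zero] at this
  refine this.congr fun k => Real.sqrt_sq (by positivity)

theorem tendsto_succ_pow_mul_pow (k : ℕ) {r : ℝ} (h0 : 0 < r) (h1 : r < 1) :
    Tendsto (fun n : ℕ => ((n : ℝ) + 1) ^ k * r ^ n) atTop (nhds 0) := by
  have h := ((tendsto_add_atTop_iff_nat 1).2
    (tendsto_pow_const_mul_const_pow_of_lt_one k h0.le h1)).mul_const r⁻¹
  rw [zero_mul] at h
  refine h.congr fun n => ?_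
  push_cast
  rw [pow_succ]
  field_simp

theorem four_lt_add {w : ℝ} (hw : 1 < w) : 4 < w + 2 + w⁻¹ := by
  have h : w + 2 + w⁻¹ - 4 = (w - 1) ^ 2 / w := by field_simp; ring
  have : 0 < (w - 1) ^ 2 / w := by
    have : 0 < w - 1 := by linarith
    positivity
  linarith

theorem tendsto_ballotSum_div_pow {w : ℝ} (hw : 1 < w) :
    Tendsto (fun k => ballotSum w k k / (w + 2 + w⁻¹) ^ k) atTop (nhds (1 - w⁻¹)) := by
  have h4 := four_lt_add hw
  have hw0 : 0 < w := by linarith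
  have h : Tendsto (fun k => ballotSum w⁻¹ k k / (w + 2 + w⁻¹) ^ k) atTop (nhds 0) := by
    refine squeeze_zero (fun k => div_nonneg (ballotSum_nonneg (by positivity) k k)
      (by positivity)) (fun k => ?_) (tendsto_pow_atTop_nhds_zero_of_lt_one
      (r := 4 / (w + 2 + w⁻¹)) (by positivity) ((div_lt_one (by linarith)).2 h4))
    rw [div_pow]
    gcongr
    exact ballotSum_le_of_le_one (by positivity) (inv_le_one_of_one_le₀ hw.le) k k
  have h' := (h.const_mul w⁻¹).const_add (1 - w⁻¹)
  rw [mul_zero, add_zero] at h'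
  refine h'.congr fun k => ?_
  rw [ballotSum_diag_eq hw0.ne' k]
  have : (w + 2 + w⁻¹) ^ k ≠ 0 := by positivity
  rw [add_div, mul_div_cancel_right₀ _ this, mul_div_assoc]

theorem tendsto_Cst_div {z : ℝ} (hz : 2 < z) :
    Tendsto (fun n => Cst n 0 z / ((z - 1 + 2 + (z - 1)⁻¹) ^ n * ballot n 0)) atTop
      (nhds ((z - 1)⁻¹ * ((1 - (z - 1)⁻¹) * (z - 1 + 2 + (z - 1)⁻¹ - 4)))) := by
  have hw : 1 < z - 1 := by linarith
  have hc := fun n => Cst_mul_pow n 0 z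
  generalize z - 1 = w at *
  have hw0 : 0 < w := by linarith
  have h4 := four_lt_add hw
  have hsmall : Tendsto (fun n => ballot n 0 / (w + 2 + w⁻¹) ^ n) atTop (nhds 0) := by
    refine squeeze_zero (fun k => div_nonneg (ballot_nonneg k 0)
      (by positivity)) (fun k => ?_) (tendsto_pow_atTop_nhds_zero_of_lt_one
      (r := 4 / (w + 2 + w⁻¹)) (by positivity) ((div_lt_one (by linarith)).2 h4))
    rw [div_pow]
    gcongr
    exact ballot_le k 0
  have h := (((tendsto_ballotSum_div_pow hw).mul
    (tendsto_ballot_succ_zero_div.const_sub (w + 2 + w⁻¹))).sub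
      (hsmall.const_mul (1 + w⁻¹))).const_mul w⁻¹
  rw [mul_zero, sub_zero] at h
  refine h.congr fun n => ?_
  have hn := hc n
  rw [ballotSum_zero, ballotSum_zero, ballotSum_diag_succ hw0.ne', zero_add, pow_one] at hn
  rw [eq_div_of_mul_eq hw0.ne' hn]
  have h0 := (ballot_zero_pos n).ne'
  have hl : (w + 2 + w⁻¹) ^ n ≠ 0 := by positivity
  generalize (w + 2 + w⁻¹) ^ n = l at *
  field_simp
  ring

/-- The normalized overlap of the profile of length `q` with the correction of length `p`. -/
noncomputable def crossError (w : ℝ) (n q p : ℕ) : ℝ :=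
  ballot p 0 * (∑ j ∈ Finset.range (n + 1), profile w q j * (ballotSum w p j / w ^ j)) /
    ((w + 2 + w⁻¹) ^ p * ballot n 0)

/-- The normalized overlap of the corrections of lengths `q` and `p`. -/
noncomputable def squareError (w : ℝ) (n q p : ℕ) : ℝ :=
  ballot q 0 * ballot p 0 *
      (∑ j ∈ Finset.range (n + 1), ballotSum w q j / w ^ j * (ballotSum w p j / w ^ j)) /
    ((w + 2 + w⁻¹) ^ n * ballot n 0)

theorem abs_crossError_le {w : ℝ} (hw : 1 < w) {n q p : ℕ} (h : q + p = n) :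
    |crossError w n q p| ≤
      (2 + 2 * (1 - w⁻¹)⁻¹) * (2 * (n + 1) ^ 2 * (4 / (w + 2 + w⁻¹)) ^ p) := by
  have hw0 : 0 < w := by linarith
  have h0 := ballot_zero_pos n
  have hu1 : 0 < 1 - w⁻¹ := sub_pos.2 (inv_lt_one_of_one_lt₀ hw)
  have hs : |∑ j ∈ Finset.range (n + 1), profile w q j * (ballotSum w p j / w ^ j)| ≤
      (2 + 2 * (1 - w⁻¹)⁻¹) * 4 ^ q * 4 ^ p := by
    refine (Finset.abs_sum_le_sum_abs _ _).trans ?_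
    calc ∑ j ∈ Finset.range (n + 1), |profile w q j * (ballotSum w p j / w ^ j)|
        ≤ ∑ j ∈ Finset.range (n + 1), |profile w q j| * 4 ^ p := by
          refine Finset.sum_le_sum fun j _ => ?_
          have hn : 0 ≤ ballotSum w p j / w ^ j :=
            div_nonneg (ballotSum_nonneg hw0.le p j) (by positivity)
          rw [abs_mul, abs_of_nonneg hn]
          exact mul_le_mul_of_nonneg_left (ballotSum_div_pow_le hw.le p j) (abs_nonneg _)
      _ ≤ _ := by
          rw [← Finset.sum_mul]
          exact mul_le_mul_of_nonneg_right (sum_abs_profile_le hw q _) (by positivity)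
  rw [crossError, abs_div, abs_mul, abs_of_pos (ballot_zero_pos p),
    abs_of_pos (show 0 < (w + 2 + w⁻¹) ^ p * ballot n 0 by positivity),
    div_le_iff₀ (by positivity)]
  calc ballot p 0 * |∑ j ∈ Finset.range (n + 1), profile w q j * (ballotSum w p j / w ^ j)|
      ≤ 4 ^ p * ((2 + 2 * (1 - w⁻¹)⁻¹) * 4 ^ q * 4 ^ p) := by
        gcongr
        exact ballot_le p 0
    _ = (2 + 2 * (1 - w⁻¹)⁻¹) * 4 ^ p * 4 ^ n := by rw [← h, pow_add]; ring
    _ ≤ (2 + 2 * (1 - w⁻¹)⁻¹) * 4 ^ p * (2 * (n + 1) ^ 2 * ballot n 0) := by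
        gcongr
        exact four_pow_le_mul_ballot_zero n
    _ = _ := by
        rw [div_pow]
        field_simp

theorem abs_squareError_le {w : ℝ} (hw : 1 < w) {n q p : ℕ} (h : q + p = n) :
    |squareError w n q p| ≤ 2 * ((n + 1) ^ 3 * (4 / (w + 2 + w⁻¹)) ^ n) := by
  have hw0 : 0 < w := by linarith
  have h0 := ballot_zero_pos n
  have hH : ∀ k j, 0 ≤ ballotSum w k j / w ^ j := fun k j =>
    div_nonneg (ballotSum_nonneg hw0.le k j) (by positivity)
  have hs0 : 0 ≤ ∑ j ∈ Finset.range (n + 1),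
      ballotSum w q j / w ^ j * (ballotSum w p j / w ^ j) :=
    Finset.sum_nonneg fun j _ => mul_nonneg (hH q j) (hH p j)
  have hs : ∑ j ∈ Finset.range (n + 1),
      ballotSum w q j / w ^ j * (ballotSum w p j / w ^ j) ≤ (n + 1) * 4 ^ n := by
    calc _ ≤ ∑ j ∈ Finset.range (n + 1), (4 : ℝ) ^ q * 4 ^ p :=
          Finset.sum_le_sum fun j _ => mul_le_mul (ballotSum_div_pow_le hw.le q j)
            (ballotSum_div_pow_le hw.le p j) (hH p j) (by positivity)
      _ = _ := by rw [Finset.sum_const, Finset.card_range, nsmul_eq_mul, ← pow_add, h]; simp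
  have hq := ballot_zero_pos q
  have hp := ballot_zero_pos p
  rw [squareError, abs_of_nonneg (by positivity), div_le_iff₀ (by positivity)]
  calc _ ≤ (4 : ℝ) ^ q * 4 ^ p * ((n + 1) * 4 ^ n) := by
        gcongr
        · exact ballot_le q 0
        · exact ballot_le p 0
    _ = (n + 1) * 4 ^ n * 4 ^ n := by rw [← pow_add, h]; ring
    _ ≤ (n + 1) * 4 ^ n * (2 * (n + 1) ^ 2 * ballot n 0) := by
        gcongr
        exact four_pow_le_mul_ballot_zero n
    _ = _ := by
        rw [div_pow]
        field_simp

theorem Zstar_div_eq {z : ℝ} (hz : 2 < z) {n q p : ℕ} (h : q + p = n) :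
    Zstar n q z / ((z - 1 + 2 + (z - 1)⁻¹) ^ n * ballot n 0) =
      ballotSum (z - 1) q q / (z - 1 + 2 + (z - 1)⁻¹) ^ q *
          (ballotSum (z - 1) p p / (z - 1 + 2 + (z - 1)⁻¹) ^ p) *
          ((z - 1)⁻¹ * (z - 1 + 2 + (z - 1)⁻¹ - ballot (n + 1) 0 / ballot n 0) +
            ((z - 1)⁻¹ * (1 + (z - 1)⁻¹) + ((z - 1)⁻¹ * (1 + (z - 1)⁻¹)) ^ 2 *
              ∑ j ∈ Finset.range (n + 1), ((z - 1)⁻¹ ^ 2) ^ j) *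
              (ballot q 0 * ballot p 0 / ballot n 0)) -
        (z - 1)⁻¹ * (1 + (z - 1)⁻¹) *
          (ballotSum (z - 1) q q / (z - 1 + 2 + (z - 1)⁻¹) ^ q * crossError (z - 1) n q p) -
        (z - 1)⁻¹ * (1 + (z - 1)⁻¹) *
          (ballotSum (z - 1) p p / (z - 1 + 2 + (z - 1)⁻¹) ^ p * crossError (z - 1) n p q) +
        ((z - 1)⁻¹ * (1 + (z - 1)⁻¹)) ^ 2 * squareError (z - 1) n q p := by
  have hz0 : 0 < z - 1 := by linarith
  have hC : ∀ k j, Cst k j z = _ := Cst_eq_profile hz0.ne'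
  rw [Zstar, show n - q = p by omega]
  simp only [hC]
  generalize z - 1 = w at *
  have hprod := sum_profile_mul_profile hz0.ne' (show q + p < n + 1 by omega)
  rw [h] at hprod
  rw [crossError, crossError, squareError]
  have e : ∑ j ∈ Finset.range (n + 1),
      (ballotSum w q q * profile w q j -
          w⁻¹ * (1 + w⁻¹) * ballot q 0 * (ballotSum w q j / w ^ j)) *
        (ballotSum w p p * profile w p j -
          w⁻¹ * (1 + w⁻¹) * ballot p 0 * (ballotSum w p j / w ^ j)) =
      ballotSum w q q * ballotSum w p p *
          ∑ j ∈ Finset.range (n + 1), profile w q j * profile w p j -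
        w⁻¹ * (1 + w⁻¹) * (ballotSum w q q * (ballot p 0 *
          ∑ j ∈ Finset.range (n + 1), profile w q j * (ballotSum w p j / w ^ j))) -
        w⁻¹ * (1 + w⁻¹) * (ballotSum w p p * (ballot q 0 *
          ∑ j ∈ Finset.range (n + 1), profile w p j * (ballotSum w q j / w ^ j))) +
        (w⁻¹ * (1 + w⁻¹)) ^ 2 * (ballot q 0 * ballot p 0 *
          ∑ j ∈ Finset.range (n + 1), ballotSum w q j / w ^ j * (ballotSum w p j / w ^ j)) := by
    simp only [Finset.mul_sum, ← Finset.sum_add_distrib, ← Finset.sum_sub_distrib]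
    exact Finset.sum_congr rfl fun j _ => by ring
  rw [e, hprod, ← h, pow_add]
  have hl : 0 < w + 2 + w⁻¹ := by positivity
  have hb := (ballot_zero_pos (q + p)).ne'
  have hlq := (pow_pos hl q).ne'
  have hlp := (pow_pos hl p).ne'
  generalize (∑ j ∈ Finset.range (q + p + 1), profile w q j * (ballotSum w p j / w ^ j)) = s1
  generalize (∑ j ∈ Finset.range (q + p + 1), profile w p j * (ballotSum w q j / w ^ j)) = s2
  generalize (∑ j ∈ Finset.range (q + p + 1),
    ballotSum w q j / w ^ j * (ballotSum w p j / w ^ j)) = s3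
  generalize (∑ j ∈ Finset.range (q + p + 1), (w⁻¹ ^ 2) ^ j) = s4
  generalize (w + 2 + w⁻¹) ^ q = lq at *
  generalize (w + 2 + w⁻¹) ^ p = lp at *
  generalize w + 2 + w⁻¹ = l at *
  generalize w⁻¹ = u at *
  field_simp

theorem tendsto_atTop_of_succ_le_mul {q : ℕ → ℕ} {K : ℝ} (hK : 0 < K)
    (hq : ∀ n : ℕ, (n : ℝ) + 1 ≤ K * (q n + 1)) : Tendsto q atTop atTop := by
  rw [← tendsto_natCast_atTop_iff (R := ℝ)]
  have h1 : Tendsto (fun n : ℕ => K⁻¹ * ((n : ℝ) + 1) - 1) atTop atTop :=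
    tendsto_atTop_add_const_right _ _ ((tendsto_atTop_add_const_right _ _
      tendsto_natCast_atTop_atTop).const_mul_atTop (inv_pos.2 hK))
  refine tendsto_atTop_mono (fun n => ?_) h1
  have : K⁻¹ * ((n : ℝ) + 1) ≤ q n + 1 := (inv_mul_le_iff₀ hK).2 (hq n)
  linarith

theorem tendsto_crossError {w K : ℝ} (hw : 1 < w) (hK : 0 < K) {q p : ℕ → ℕ}
    (h : ∀ n, q n + p n = n) (hp : ∀ n : ℕ, (n : ℝ) + 1 ≤ K * (p n + 1)) :
    Tendsto (fun n => crossError w n (q n) (p n)) atTop (nhds 0) := by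
  have h4 := four_lt_add hw
  have hl : 0 < w + 2 + w⁻¹ := by linarith
  have hu1 : 0 < 1 - w⁻¹ := sub_pos.2 (inv_lt_one_of_one_lt₀ hw)
  have hlim := (((tendsto_succ_pow_mul_pow 2 (div_pos four_pos hl)
    ((div_lt_one hl).2 h4)).comp (tendsto_atTop_of_succ_le_mul hK hp)).const_mul
      (2 * K ^ 2)).const_mul (2 + 2 * (1 - w⁻¹)⁻¹)
  rw [mul_zero, mul_zero] at hlim
  refine squeeze_zero_norm (fun n => ?_) hlim
  refine (abs_crossError_le hw (h n)).trans ?_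
  simp only [Function.comp_apply]
  refine mul_le_mul_of_nonneg_left ?_ (by positivity)
  have : ((n : ℝ) + 1) ^ 2 ≤ (K * (p n + 1)) ^ 2 := by gcongr; exact hp n
  calc 2 * ((n : ℝ) + 1) ^ 2 * (4 / (w + 2 + w⁻¹)) ^ p n
      ≤ 2 * (K * (p n + 1)) ^ 2 * (4 / (w + 2 + w⁻¹)) ^ p n := by gcongr
    _ = _ := by ring

theorem tendsto_squareError {w : ℝ} (hw : 1 < w) {q p : ℕ → ℕ} (h : ∀ n, q n + p n = n) :
    Tendsto (fun n => squareError w n (q n) (p n)) atTop (nhds 0) := by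
  have h4 := four_lt_add hw
  have hl : 0 < w + 2 + w⁻¹ := by linarith
  have hlim := (tendsto_succ_pow_mul_pow 3 (div_pos four_pos hl)
    ((div_lt_one hl).2 h4)).const_mul 2
  rw [mul_zero] at hlim
  exact squeeze_zero_norm (fun n => abs_squareError_le hw (h n)) hlim

theorem tendsto_ballot_mul_ballot_div {K : ℝ} (hK : 0 < K) {q p : ℕ → ℕ}
    (h : ∀ n, q n + p n = n) (hq : ∀ n : ℕ, (n : ℝ) + 1 ≤ K * (q n + 1))
    (hp : ∀ n : ℕ, (n : ℝ) + 1 ≤ K * (p n + 1)) :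
    Tendsto (fun n => ballot (q n) 0 * ballot (p n) 0 / ballot n 0) atTop (nhds 0) := by
  have hlim := ((tendsto_centralBinom_div_four_pow.comp (tendsto_atTop_of_succ_le_mul hK hq)).mul
    (tendsto_centralBinom_div_four_pow.comp (tendsto_atTop_of_succ_le_mul hK hp))).const_mul
      (2 * K ^ 2)
  rw [mul_zero, mul_zero] at hlim
  refine squeeze_zero (fun n => div_nonneg (mul_nonneg (ballot_nonneg _ _) (ballot_nonneg _ _))
    (ballot_nonneg _ _)) (fun n => ?_) hlim
  have hq0 := ballot_zero_pos (q n)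
  have hp0 := ballot_zero_pos (p n)
  simp only [Function.comp_apply, ← succ_mul_ballot_zero]
  rw [div_le_iff₀ (ballot_zero_pos n)]
  have hsq : ((n : ℝ) + 1) ^ 2 ≤ K ^ 2 * ((q n + 1) * (p n + 1)) := by
    calc ((n : ℝ) + 1) ^ 2 = ((n : ℝ) + 1) * ((n : ℝ) + 1) := sq _
      _ ≤ (K * (q n + 1)) * (K * (p n + 1)) :=
          mul_le_mul (hq n) (hp n) (by positivity) (by positivity)
      _ = _ := by ring
  have h4 : (4 : ℝ) ^ q n * 4 ^ p n ≤ 2 * (K ^ 2 * ((q n + 1) * (p n + 1))) * ballot n 0 := by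
    rw [← pow_add, h n]
    refine (four_pow_le_mul_ballot_zero n).trans ?_
    have := ballot_nonneg n 0
    gcongr
  calc ballot (q n) 0 * ballot (p n) 0
      = ballot (q n) 0 * ballot (p n) 0 / (4 ^ q n * 4 ^ p n) * (4 ^ q n * 4 ^ p n) := by
        field_simp
    _ ≤ ballot (q n) 0 * ballot (p n) 0 / (4 ^ q n * 4 ^ p n) *
          (2 * (K ^ 2 * ((q n + 1) * (p n + 1))) * ballot n 0) :=
        mul_le_mul_of_nonneg_left h4 (by positivity)
    _ = _ := by ring

theorem tendsto_Zstar_div_Cst {z K : ℝ} (hz : 2 < z) (hK : 0 < K) {q p : ℕ → ℕ}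
    (h : ∀ n, q n + p n = n) (hq : ∀ n : ℕ, (n : ℝ) + 1 ≤ K * (q n + 1))
    (hp : ∀ n : ℕ, (n : ℝ) + 1 ≤ K * (p n + 1)) :
    Tendsto (fun n => Zstar n (q n) z / Cst n 0 z) atTop (nhds (1 - (z - 1)⁻¹)) := by
  have hw : 1 < z - 1 := by linarith
  have hden := tendsto_Cst_div hz
  have hZ := fun n => Zstar_div_eq hz (h n)
  generalize z - 1 = w at *
  have hw0 : 0 < w := by linarith
  have h4 := four_lt_add hw
  have hu0 : 0 < w⁻¹ := by positivity
  have hu1 : w⁻¹ < 1 := inv_lt_one_of_one_lt₀ hw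
  have hbq := (tendsto_ballotSum_div_pow hw).comp (tendsto_atTop_of_succ_le_mul hK hq)
  have hbp := (tendsto_ballotSum_div_pow hw).comp (tendsto_atTop_of_succ_le_mul hK hp)
  have hgeom : Tendsto (fun n : ℕ => ∑ j ∈ Finset.range (n + 1), (w⁻¹ ^ 2) ^ j) atTop
      (nhds (1 - w⁻¹ ^ 2)⁻¹) :=
    (tendsto_add_atTop_iff_nat 1).2 (hasSum_geometric_of_lt_one (by positivity)
      (pow_lt_one₀ hu0.le hu1 two_ne_zero)).tendsto_sum_nat
  have hnum := ((((hbq.mul hbp).mul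
    (((tendsto_ballot_succ_zero_div.const_sub (w + 2 + w⁻¹)).const_mul w⁻¹).add
      (((hgeom.const_mul ((w⁻¹ * (1 + w⁻¹)) ^ 2)).const_add (w⁻¹ * (1 + w⁻¹))).mul
        (tendsto_ballot_mul_ballot_div hK h hq hp)))).sub
    ((hbq.mul (tendsto_crossError hw hK h hp)).const_mul (w⁻¹ * (1 + w⁻¹)))).sub
    ((hbp.mul (tendsto_crossError hw hK (fun n => (add_comm _ _).trans (h n)) hq)).const_mul
      (w⁻¹ * (1 + w⁻¹)))).add
    ((tendsto_squareError hw h).const_mul ((w⁻¹ * (1 + w⁻¹)) ^ 2))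
  have hne : w⁻¹ * ((1 - w⁻¹) * (w + 2 + w⁻¹ - 4)) ≠ 0 :=
    (mul_pos hu0 (mul_pos (sub_pos.2 hu1) (sub_pos.2 h4))).ne'
  have hlim : (1 - w⁻¹) * (1 - w⁻¹) * (w⁻¹ * (w + 2 + w⁻¹ - 4)) /
      (w⁻¹ * ((1 - w⁻¹) * (w + 2 + w⁻¹ - 4))) = 1 - w⁻¹ := by
    rw [div_eq_iff hne]
    ring
  simp only [mul_zero, add_zero, sub_zero] at hnum
  have hfinal := hnum.div hden hne
  rw [hlim] at hfinal
  refine hfinal.congr fun n => ?_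
  have hscale : (w + 2 + w⁻¹) ^ n * ballot n 0 ≠ 0 :=
    mul_ne_zero (by positivity) (ballot_zero_pos n).ne'
  simp only [Pi.div_apply, Function.comp_apply]
  rw [← hZ n, div_div_div_cancel_right₀ hscale]

end Ballot

/-- In the adsorbed phase `z > 2`, for `a ∈ (0,1)`, the staircase-polygon pressure at the
point `2⌊an/2⌋` tends to the nonzero constant `−log(z−1)`. -/
theorem staircase_pressure_adsorbed (z : ℝ) (hz : 2 < z) (a : ℝ) (ha0 : 0 < a) (ha1 : a < 1) :
    Tendsto (fun n : ℕ => PS n (2 * ⌊a * (n : ℝ) / 2⌋₊) z) atTop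
      (nhds (-Real.log (z - 1))) := by
  have hfl : ∀ n : ℕ, ((2 * ⌊a * (n : ℝ) / 2⌋₊ : ℕ) : ℝ) ≤ a * n := fun n => by
    have := Nat.floor_le (show 0 ≤ a * (n : ℝ) / 2 by positivity)
    push_cast
    linarith
  have hfl' : ∀ n : ℕ, a * n ≤ ((2 * ⌊a * (n : ℝ) / 2⌋₊ : ℕ) : ℝ) + 2 := fun n => by
    have := Nat.lt_floor_add_one (a * (n : ℝ) / 2)
    push_cast
    linarith
  have hle : ∀ n : ℕ, 2 * ⌊a * (n : ℝ) / 2⌋₊ ≤ n := fun n => by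
    have : ((2 * ⌊a * (n : ℝ) / 2⌋₊ : ℕ) : ℝ) ≤ n :=
      (hfl n).trans (mul_le_of_le_one_left n.cast_nonneg ha1.le)
    exact_mod_cast this
  have h1a : 0 < 1 - a := by linarith
  have hratio := Ballot.tendsto_Zstar_div_Cst hz
    (K := 3 / a + 1 / (1 - a)) (by positivity)
    (q := fun n => 2 * ⌊a * (n : ℝ) / 2⌋₊) (p := fun n => n - 2 * ⌊a * (n : ℝ) / 2⌋₊)
    (fun n => Nat.add_sub_of_le (hle n)) (fun n => ?_) (fun n => ?_)
  · have hlog := (hratio.const_sub 1).log (by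
      have : (0 : ℝ) < (z - 1)⁻¹ := inv_pos.2 (by linarith)
      linarith)
    rw [sub_sub_cancel, Real.log_inv] at hlog
    exact hlog
  · have h0 : (0 : ℝ) ≤ ((2 * ⌊a * (n : ℝ) / 2⌋₊ : ℕ) : ℝ) := Nat.cast_nonneg _
    have h := hfl' n
    generalize ((2 * ⌊a * (n : ℝ) / 2⌋₊ : ℕ) : ℝ) = q at *
    have h3 : (n : ℝ) + 1 ≤ 3 / a * (q + 1) := by
      rw [div_mul_eq_mul_div, le_div_iff₀ ha0]
      linarith
    have : 0 ≤ 1 / (1 - a) * (q + 1) := by positivity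
    linarith
  · have h := hfl n
    rw [Nat.cast_sub (hle n)]
    have h0 : (0 : ℝ) ≤ n - ((2 * ⌊a * (n : ℝ) / 2⌋₊ : ℕ) : ℝ) :=
      sub_nonneg.2 (by exact_mod_cast hle n)
    generalize ((2 * ⌊a * (n : ℝ) / 2⌋₊ : ℕ) : ℝ) = q at *
    have h3 : (n : ℝ) + 1 ≤ 1 / (1 - a) * (n - q + 1) := by
      rw [div_mul_eq_mul_div, le_div_iff₀ h1a]
      linarith
    have : 0 ≤ 3 / a * (n - q + 1) := by positivity
    linarith
end
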